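/- arXiv:1804.01415 — 9 statements merged into one kernel-verified Lean document; each statement's English description precedes it below -/
import Mathlib

section
/- Let N ≥ 1, p > 1, s ∈ (0,1), and let K ⊂ ℝ^N be a Lebesgue measurable set with 0 < |K| < ∞. Then for every x ∈ ℝ^N, ∫_{ℝ^N \ K} |x − y|^{−(N+sp)} dy ≥ C |K|^{−sp/N}, where C = C(N,s,p) > 0 is a constant depending only on N, s, p (explicitly one may take C = (σ(S^{N−1})/(sp)) · (σ(S^{N−1})/N)^{sp/N}, with σ(S^{N−1}) the surface measure of the unit sphere). (This is the Euclidean specialization of the paper's Lemma on lower bounds of the kernel integral over complements of sets.) -/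
open MeasureTheory

/-- If a ball has twice the measure of `K`, then the integral over `Kᶜ` of a
nonpositive power of the distance to the centre is at least `μ K` times the value of that power at
the radius. -/
theorem measure_mul_rpow_le_lintegral_compl {E : Type*} [NormedAddCommGroup E]
    [MeasurableSpace E] [OpensMeasurableSpace E] (μ : Measure E)
    [NullSingletonClass μ] {K : Set E} (hK : MeasurableSet K) (hfin : μ K ≠ ⊤) (x : E) {r a : ℝ}
    (ha : a ≤ 0) (hball : μ (Metric.ball x r) = 2 * μ K) :
    μ K * ENNReal.ofReal (r ^ a) ≤ ∫⁻ y in Kᶜ, ENNReal.ofReal (‖x - y‖ ^ a) ∂μ := by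
  have hS : MeasurableSet ((Metric.ball x r \ {x}) \ K) :=
    (Metric.isOpen_ball.measurableSet.diff (measurableSet_singleton x)).diff hK
  have hmeas : μ K ≤ μ ((Metric.ball x r \ {x}) \ K) := by
    have h := le_measure_sdiff (μ := μ) (s₁ := Metric.ball x r \ {x}) (s₂ := K)
    rw [measure_sdiff_null (measure_singleton x), hball, two_mul,
      ENNReal.add_sub_cancel_right hfin] at h
    exact h
  calc μ K * ENNReal.ofReal (r ^ a)
      ≤ ENNReal.ofReal (r ^ a) * μ ((Metric.ball x r \ {x}) \ K) := by
        rw [mul_comm]; gcongr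
    _ = ∫⁻ _ in (Metric.ball x r \ {x}) \ K, ENNReal.ofReal (r ^ a) ∂μ := by
        rw [setLIntegral_const]
    _ ≤ ∫⁻ y in (Metric.ball x r \ {x}) \ K, ENNReal.ofReal (‖x - y‖ ^ a) ∂μ := by
        refine setLIntegral_mono' hS fun y hy => ENNReal.ofReal_le_ofReal ?_
        obtain ⟨⟨hyr, hyx⟩, -⟩ := hy
        refine Real.rpow_le_rpow_of_nonpos (norm_sub_pos_iff.2 (Ne.symm hyx)) ?_ ha
        rw [← dist_eq_norm, dist_comm]
        exact (Metric.mem_ball.1 hyr).le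
    _ ≤ _ := lintegral_mono_set fun _ hy => hy.2

/-- For `N ≥ 1`, `p > 1`, `s ∈ (0,1)` there is a constant `C = C(N,s,p) > 0` such that for
every Lebesgue measurable `K ⊆ ℝ^N` with `0 < |K| < ∞` and every `x ∈ ℝ^N`,
`∫_{ℝ^N \ K} |x - y|^{-(N+sp)} dy ≥ C |K|^{-sp/N}`. -/
theorem lintegral_compl_fractional_kernel_lower_bound
    (N : ℕ) (hN : 1 ≤ N) (p s : ℝ) (hp : 1 < p) (hs : s ∈ Set.Ioo (0 : ℝ) 1) :
    ∃ C : ℝ, 0 < C ∧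
      ∀ K : Set (EuclideanSpace ℝ (Fin N)), MeasurableSet K →
        0 < volume K → volume K < ⊤ →
        ∀ x : EuclideanSpace ℝ (Fin N),
          ENNReal.ofReal (C * (volume K).toReal ^ (-(s * p) / (N : ℝ))) ≤
            ∫⁻ y in Kᶜ, ENNReal.ofReal (‖x - y‖ ^ (-((N : ℝ) + s * p))) := by
  have hN0 : (0 : ℝ) < N := by exact_mod_cast hN
  have hsp : 0 < s * p := mul_pos hs.1 (by linarith)
  have : Nonempty (Fin N) := ⟨⟨0, hN⟩⟩
  have hfin₁ : volume (Metric.ball (0 : EuclideanSpace ℝ (Fin N)) 1) ≠ ⊤ := measure_ball_lt_top.ne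
  have hω : 0 < (volume (Metric.ball (0 : EuclideanSpace ℝ (Fin N)) 1)).toReal :=
    ENNReal.toReal_pos (Metric.measure_ball_pos _ _ one_pos).ne' hfin₁
  set ω := (volume (Metric.ball (0 : EuclideanSpace ℝ (Fin N)) 1)).toReal with hω_def
  refine ⟨(2 / ω) ^ (-((N : ℝ) + s * p) / N), by positivity, fun K hK hpos hlt x => ?_⟩
  have hk : 0 < (volume K).toReal := ENNReal.toReal_pos hpos.ne' hlt.ne
  set k := (volume K).toReal
  have hKk : volume K = ENNReal.ofReal k := (ENNReal.ofReal_toReal hlt.ne).symm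
  set r := (2 / ω * k) ^ (1 / (N : ℝ)) with hr_def
  have hr : 0 < r := by positivity
  have hrN : r ^ N = 2 / ω * k := by
    rw [hr_def, one_div, Real.rpow_inv_natCast_pow (by positivity) (by lia)]
  have hball : volume (Metric.ball x r) = 2 * volume K := by
    rw [Measure.addHaar_ball _ _ hr.le, finrank_euclideanSpace_fin, hrN,
      ← ENNReal.ofReal_toReal hfin₁, ← hω_def, ← ENNReal.ofReal_mul (by positivity), hKk,
      ← ENNReal.ofReal_ofNat 2, ← ENNReal.ofReal_mul zero_le_two]
    congr 1
    field_simp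
  refine le_trans (le_of_eq ?_) (measure_mul_rpow_le_lintegral_compl volume hK hlt.ne x
    (by linarith : -((N : ℝ) + s * p) ≤ 0) hball)
  rw [hKk, ← ENNReal.ofReal_mul hk.le, hr_def, ← Real.rpow_mul (by positivity),
    one_div_mul_eq_div, Real.mul_rpow (by positivity) hk.le, mul_left_comm]
  congr 2
  rw [← Real.rpow_one_add' hk.le]
  · congr 1
    field_simp
    ring
  · have : 1 + -((N : ℝ) + s * p) / N = -(s * p / N) := by field_simp; ring
    rw [this]
    exact (neg_neg_of_pos (by positivity)).ne
end

section
/- Fix T > 1, p > 1, s ∈ (0,1) and Q > sp. Let m ∈ ℤ and let (a_k)_{k∈ℤ} be a bounded, non-increasing sequence of nonnegative real numbers with a_k = 0 for all k ≥ m. Then Σ_{k∈ℤ} a_k^{(Q−sp)/Q} T^k ≤ C Σ_{k∈ℤ, a_k ≠ 0} a_{k+1} a_k^{−sp/Q} T^k, for a positive constant C = C(Q,s,p,T) depending only on Q, s, p, T. -/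
/-- A sublinear power `y ^ (1 - σ)` is controlled by the linear term `y * x ^ (-σ)` up to an
arbitrarily small multiple `δ ^ (1 - σ)` of `x ^ (1 - σ)`. -/
theorem Real.rpow_one_sub_le_mul_add {x y δ σ : ℝ} (hx : 0 < x) (hy : 0 ≤ y) (hδ : 0 < δ)
    (hσ₀ : 0 ≤ σ) (hσ₁ : σ ≤ 1) :
    y ^ (1 - σ) ≤ δ ^ (-σ) * (y * x ^ (-σ)) + δ ^ (1 - σ) * x ^ (1 - σ) := by
  have hδx : 0 < δ * x := mul_pos hδ hx
  rcases le_total y (δ * x) with h | h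
  · calc y ^ (1 - σ) ≤ (δ * x) ^ (1 - σ) := Real.rpow_le_rpow hy h (by linarith)
      _ = δ ^ (1 - σ) * x ^ (1 - σ) := Real.mul_rpow hδ.le hx.le
      _ ≤ _ := le_add_of_nonneg_left (by positivity)
  · have hy' : 0 < y := hδx.trans_le h
    calc y ^ (1 - σ) = y * y ^ (-σ) := by
          rw [sub_eq_add_neg, Real.rpow_add hy', Real.rpow_one]
      _ ≤ y * (δ * x) ^ (-σ) :=
          mul_le_mul_of_nonneg_left
            (Real.rpow_le_rpow_of_nonpos hδx h (neg_nonpos.2 hσ₀)) hy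
      _ = δ ^ (-σ) * (y * x ^ (-σ)) := by
          rw [Real.mul_rpow hδ.le hx.le]; ring
      _ ≤ _ := le_add_of_nonneg_right (by positivity)

/-- A bounded weight vanishing at large integers is summable against `T ^ k` when `T > 1`. -/
theorem summable_int_mul_zpow_of_bounded {T : ℝ} (hT : 1 < T) {m : ℤ} {b : ℤ → ℝ} {B : ℝ}
    (hb₀ : ∀ k, 0 ≤ b k) (hbB : ∀ k, b k ≤ B) (hbm : ∀ k, m ≤ k → b k = 0) :
    Summable fun k : ℤ => b k * T ^ k := by
  have hT₀ : 0 < T := one_pos.trans hT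
  refine Summable.of_nat_of_neg ?_ ?_
  · refine summable_of_ne_finset_zero (s := Finset.range m.toNat) fun n hn => ?_
    rw [Finset.mem_range, not_lt] at hn
    rw [hbm n (by omega), zero_mul]
  · have hgeom : Summable fun n : ℕ => B * T⁻¹ ^ n :=
      (summable_geometric_of_lt_one (by positivity) (inv_lt_one_of_one_lt₀ hT)).mul_left B
    refine hgeom.of_nonneg_of_le (fun n => mul_nonneg (hb₀ _) (by positivity)) fun n => ?_
    rw [zpow_neg, zpow_natCast, inv_pow]
    exact mul_le_mul_of_nonneg_right (hbB _) (by positivity)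


/-- Fix `T > 1`, `p > 1`, `s ∈ (0,1)` and `Q > sp`. There is a constant `C = C(Q,s,p,T) > 0`
such that for every `m : ℤ` and every bounded, non-increasing, nonnegative sequence
`(a_k)_{k ∈ ℤ}` with `a_k = 0` for `k ≥ m`,
`Σ_{k∈ℤ} a_k^{(Q-sp)/Q} T^k ≤ C Σ_{k∈ℤ, a_k ≠ 0} a_{k+1} a_k^{-sp/Q} T^k`. -/
theorem summation_lemma_fractional_sobolev
    (T p s Q : ℝ) (hT : 1 < T) (hp : 1 < p) (hs : s ∈ Set.Ioo (0 : ℝ) 1) (hQ : s * p < Q) :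
    ∃ C : ℝ, 0 < C ∧
      ∀ (m : ℤ) (a : ℤ → ℝ),
        (∃ M : ℝ, ∀ k, a k ≤ M) →
        (∀ k, a (k + 1) ≤ a k) →
        (∀ k, 0 ≤ a k) →
        (∀ k, m ≤ k → a k = 0) →
        ∑' k : ℤ, ENNReal.ofReal (a k ^ ((Q - s * p) / Q) * T ^ k) ≤
          ENNReal.ofReal C *
            ∑' k : ℤ, ENNReal.ofReal
              (if a k ≠ 0 then a (k + 1) * a k ^ (-(s * p) / Q) * T ^ k else 0) := by
  have hT₀ : 0 < T := one_pos.trans hT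
  have hsp : 0 < s * p := mul_pos hs.1 (one_pos.trans hp)
  have hQ₀ : 0 < Q := hsp.trans hQ
  obtain ⟨σ, hσ⟩ : ∃ σ, σ = s * p / Q := ⟨_, rfl⟩
  have hσ₀ : 0 ≤ σ := hσ ▸ (by positivity)
  have hσ₁ : 0 < 1 - σ := by
    rw [hσ, sub_pos, div_lt_one hQ₀]; exact hQ
  have hθ : (Q - s * p) / Q = 1 - σ := by rw [hσ, sub_div, div_self hQ₀.ne']
  rw [hθ, neg_div, ← hσ]
  set δ : ℝ := (1 / (2 * T)) ^ (1 - σ)⁻¹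
  have hδ : 0 < δ := by positivity
  have hδσ : T * δ ^ (1 - σ) = 1 / 2 := by
    rw [Real.rpow_inv_rpow (by positivity) hσ₁.ne']
    field_simp
  refine ⟨2 * (T * δ ^ (-σ)), by positivity, ?_⟩
  rintro m a ⟨M, hM⟩ hmono ha hm
  set L : ℤ → ENNReal := fun k => ENNReal.ofReal (a k ^ (1 - σ) * T ^ k) with hL
  set R : ℤ → ENNReal := fun k => ENNReal.ofReal
    (if a k ≠ 0 then a (k + 1) * a k ^ (-σ) * T ^ k else 0) with hR
  have hfin : ∑' k, L k ≠ ⊤ :=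
    (summable_int_mul_zpow_of_bounded hT (fun k => Real.rpow_nonneg (ha k) _)
      (fun k => Real.rpow_le_rpow (ha k) (hM k) hσ₁.le)
      (fun k hk => by rw [hm k hk, Real.zero_rpow hσ₁.ne'])).tsum_ofReal_ne_top
  have hstep (k : ℤ) : L (k + 1) ≤ ENNReal.ofReal (T * δ ^ (-σ)) * R k + 2⁻¹ * L k := by
    rcases (ha k).eq_or_lt with h0 | hpos
    · have hk1 : a (k + 1) = 0 := le_antisymm (h0 ▸ hmono k) (ha _)
      simp [hL, hk1, Real.zero_rpow hσ₁.ne']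
    · have hTk : 0 < T ^ k := zpow_pos hT₀ k
      have hk1 := ha (k + 1)
      have hhalf : (2⁻¹ : ENNReal) = ENNReal.ofReal (1 / 2) := by
        rw [one_div, ENNReal.ofReal_inv_of_pos two_pos, ENNReal.ofReal_ofNat]
      simp only [hL, hR, if_pos hpos.ne']
      rw [hhalf, ← ENNReal.ofReal_mul (by positivity), ← ENNReal.ofReal_mul (by positivity),
        ← ENNReal.ofReal_add (by positivity) (by positivity)]
      refine ENNReal.ofReal_le_ofReal ?_
      calc a (k + 1) ^ (1 - σ) * T ^ (k + 1) = a (k + 1) ^ (1 - σ) * (T * T ^ k) := by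
            rw [zpow_add_one₀ hT₀.ne', mul_comm T]
        _ ≤ (δ ^ (-σ) * (a (k + 1) * a k ^ (-σ)) + δ ^ (1 - σ) * a k ^ (1 - σ)) * (T * T ^ k) := by
            gcongr
            exact Real.rpow_one_sub_le_mul_add hpos hk1 hδ hσ₀ (by linarith)
        _ = _ := by rw [← hδσ]; ring
  have hsum : ∑' k, L k ≤ ENNReal.ofReal (T * δ ^ (-σ)) * ∑' k, R k + 2⁻¹ * ∑' k, L k := by
    calc ∑' k, L k = ∑' k, L (k + 1) := ((Equiv.addRight (1 : ℤ)).tsum_eq L).symm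
      _ ≤ ∑' k, (ENNReal.ofReal (T * δ ^ (-σ)) * R k + 2⁻¹ * L k) := ENNReal.tsum_le_tsum hstep
      _ = _ := by rw [ENNReal.tsum_add, ENNReal.tsum_mul_left, ENNReal.tsum_mul_left]
  have hhalf : 2⁻¹ * ∑' k, L k ≤ ENNReal.ofReal (T * δ ^ (-σ)) * ∑' k, R k := by
    have hne : 2⁻¹ * ∑' k, L k ≠ ⊤ := ENNReal.mul_ne_top (by simp) hfin
    refine (ENNReal.add_le_add_iff_right hne).1 ?_
    rwa [← add_mul, ENNReal.inv_two_add_inv_two, one_mul]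
  calc ∑' k, L k = 2 * (2⁻¹ * ∑' k, L k) := by
        rw [← mul_assoc, ENNReal.mul_inv_cancel two_ne_zero ENNReal.ofNat_ne_top, one_mul]
    _ ≤ 2 * (ENNReal.ofReal (T * δ ^ (-σ)) * ∑' k, R k) := by gcongr
    _ = _ := by rw [ENNReal.ofReal_mul two_pos.le, ENNReal.ofReal_ofNat, mul_assoc]
end

section
/- Let N ≥ 1, p > 1, s ∈ (0,1) with N > sp. Let u ∈ L^∞(ℝ^N) be measurable and compactly supported, and for k ∈ ℤ set a_k := |{x ∈ ℝ^N : |u(x)| > 2^k}| (Lebesgue measure of the superlevel set). Then there exists a constant C = C(N,p,s) > 0 such that C Σ_{k∈ℤ, a_k ≠ 0} a_{k+1} a_k^{−sp/N} 2^{kp} ≤ [u]_{s,p}^p. -/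
open MeasureTheory

/-- Among sets `E` of given finite positive measure, the integral of `‖x - y‖^{-(N+σ)}` over the
complement of `E` is bounded below, up to a constant, by `|E|^{-σ/N}`. -/
theorem exists_const_mul_volume_rpow_le_lintegral_compl (N : ℕ) (hN : 1 ≤ N) (σ : ℝ)
    (hσ : 0 ≤ σ) :
    ∃ c : ℝ, 0 < c ∧ ∀ (E : Set (EuclideanSpace ℝ (Fin N))) (x : EuclideanSpace ℝ (Fin N)),
      MeasurableSet E → x ∈ E → volume E ≠ 0 → volume E ≠ ⊤ →
        ENNReal.ofReal c * volume E ^ (-σ / (N : ℝ)) ≤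
          ∫⁻ y in Eᶜ, ENNReal.ofReal (1 / ‖x - y‖ ^ ((N : ℝ) + σ)) := by
  have hN0 : (0 : ℝ) < N := by exact_mod_cast hN
  set ω : ℝ := (volume (Metric.ball (0 : EuclideanSpace ℝ (Fin N)) 1)).toReal with hω
  have hωtop : volume (Metric.ball (0 : EuclideanSpace ℝ (Fin N)) 1) ≠ ⊤ :=
    measure_ball_lt_top.ne
  have hωpos : 0 < ω :=
    ENNReal.toReal_pos (Metric.measure_ball_pos volume _ one_pos).ne' hωtop
  refine ⟨(2 / ω) ^ (-(1 + σ / N)), by positivity, fun E x hE hx h0 htop => ?_⟩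
  set m : ℝ := (volume E).toReal with hm
  have hmpos : 0 < m := ENNReal.toReal_pos h0 htop
  have hEm : volume E = ENNReal.ofReal m := (ENNReal.ofReal_toReal htop).symm
  set R : ℝ := (2 / ω * m) ^ (1 / (N : ℝ)) with hR
  have hRpos : 0 < R := by positivity
  have hRN : R ^ N = 2 / ω * m := by
    rw [hR, ← Real.rpow_natCast, ← Real.rpow_mul (by positivity), one_div_mul_cancel hN0.ne',
      Real.rpow_one]
  have hball : volume (Metric.ball x R) = ENNReal.ofReal (2 * m) := by
    rw [Measure.addHaar_ball_of_pos volume x hRpos, finrank_euclideanSpace_fin, hRN,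
      ← ENNReal.ofReal_toReal hωtop, ← hω, ← ENNReal.ofReal_mul (by positivity)]
    congr 1
    field_simp
  have hdiff : ENNReal.ofReal m ≤ volume (Metric.ball x R \ E) := by
    refine le_trans ?_ le_measure_sdiff
    rw [hball, hEm, ← ENNReal.ofReal_sub _ hmpos.le]
    exact ENNReal.ofReal_le_ofReal (by linarith)
  have hconst : (2 / ω) ^ (-(1 + σ / N)) * m ^ (-σ / (N : ℝ)) = 1 / R ^ ((N : ℝ) + σ) * m := by
    have hexp : 1 / (N : ℝ) * (N + σ) = 1 + σ / N := by field_simp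
    have hm' : m ^ (-σ / (N : ℝ)) = m ^ (-(1 + σ / N)) * m := by
      rw [← Real.rpow_add_one hmpos.ne']
      congr 1
      ring
    rw [hR, ← Real.rpow_mul (by positivity), hexp, one_div, ← Real.rpow_neg (by positivity),
      Real.mul_rpow (by positivity) hmpos.le, hm', mul_assoc]
  calc ENNReal.ofReal ((2 / ω) ^ (-(1 + σ / N))) * volume E ^ (-σ / (N : ℝ))
      = ENNReal.ofReal (1 / R ^ ((N : ℝ) + σ)) * ENNReal.ofReal m := by
        rw [hEm, ENNReal.ofReal_rpow_of_pos hmpos, ← ENNReal.ofReal_mul (by positivity), hconst,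
          ENNReal.ofReal_mul (by positivity)]
    _ ≤ ENNReal.ofReal (1 / R ^ ((N : ℝ) + σ)) * volume (Metric.ball x R \ E) := by gcongr
    _ = ∫⁻ _ in Metric.ball x R \ E, ENNReal.ofReal (1 / R ^ ((N : ℝ) + σ)) :=
        (setLIntegral_const _ _).symm
    _ ≤ ∫⁻ y in Metric.ball x R \ E, ENNReal.ofReal (1 / ‖x - y‖ ^ ((N : ℝ) + σ)) := by
        refine setLIntegral_mono' (measurableSet_ball.diff hE) fun y hy => ?_
        have hxy : 0 < ‖x - y‖ := norm_sub_pos_iff.2 fun h => hy.2 (h ▸ hx)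
        have hle : ‖x - y‖ ≤ R := by
          rw [← dist_eq_norm, dist_comm]
          exact (Metric.mem_ball.1 hy.1).le
        gcongr
    _ ≤ ∫⁻ y in Eᶜ, ENNReal.ofReal (1 / ‖x - y‖ ^ ((N : ℝ) + σ)) :=
        lintegral_mono_set fun _ hy => hy.2

/-- The sum of `2^{kp}` over the dyadic levels `2^k` separating `b` from `a / 2` is controlled by
`(a - b)^p`. -/
theorem tsum_dyadic_between_le (p : ℝ) (hp : 1 ≤ p) (a b : ℝ) :
    ∑' k : ℤ, (if (2 : ℝ) ^ (k + 1) < a ∧ b ≤ (2 : ℝ) ^ k then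
      ENNReal.ofReal (((2 : ℝ) ^ k) ^ p) else 0) ≤ 2 * ENNReal.ofReal (|a - b| ^ p) := by
  set f : ℤ → ENNReal := fun k => if (2 : ℝ) ^ (k + 1) < a ∧ b ≤ (2 : ℝ) ^ k then
      ENNReal.ofReal (((2 : ℝ) ^ k) ^ p) else 0 with hf
  by_cases hex : ∃ k : ℤ, (2 : ℝ) ^ (k + 1) < a ∧ b ≤ (2 : ℝ) ^ k
  swap
  · have : ∀ k, f k = 0 := fun k => if_neg fun h => hex ⟨k, h⟩
    exact (ENNReal.tsum_eq_zero.2 this).trans_le zero_le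
  obtain ⟨n, hn⟩ := pow_unbounded_of_one_lt a (one_lt_two (α := ℝ))
  obtain ⟨K, ⟨hKa, hKb⟩, hmax⟩ := Int.exists_greatest_of_bdd
    (P := fun k : ℤ => (2 : ℝ) ^ (k + 1) < a ∧ b ≤ (2 : ℝ) ^ k)
    ⟨n, fun k hk => by
      have h : (2 : ℝ) ^ (k + 1) < (2 : ℝ) ^ (n : ℤ) := by
        rw [zpow_natCast]
        exact hk.1.trans hn
      have := (zpow_lt_zpow_iff_right₀ (one_lt_two (α := ℝ))).1 h
      omega⟩ hex
  have hinj : Function.Injective fun n : ℕ => K - (n : ℤ) := fun i j h => by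
    simpa using h
  have hsupp : Function.support f ⊆ Set.range fun n : ℕ => K - (n : ℤ) := fun k hk => by
    have hP : (2 : ℝ) ^ (k + 1) < a ∧ b ≤ (2 : ℝ) ^ k := by
      by_contra h
      exact hk (if_neg h)
    have := hmax k hP
    exact ⟨(K - k).toNat, by simp only; omega⟩
  have hterm : ∀ n : ℕ, f (K - n) ≤ ENNReal.ofReal (|a - b| ^ p) * 2⁻¹ ^ n := fun n => by
    have hhalf : (2⁻¹ : ENNReal) ^ n = ENNReal.ofReal ((2⁻¹ : ℝ) ^ n) := by
      rw [ENNReal.ofReal_pow (by norm_num), ENNReal.ofReal_inv_of_pos two_pos]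
      norm_num
    have hlevel : (2 : ℝ) ^ K ≤ |a - b| := by
      rw [zpow_add_one₀ two_ne_zero] at hKa
      exact le_trans (by linarith) (le_abs_self _)
    have hle : ((2 : ℝ) ^ (K - n)) ^ p ≤ |a - b| ^ p * 2⁻¹ ^ n := by
      rw [zpow_sub₀ two_ne_zero, zpow_natCast, div_eq_mul_inv, ← inv_pow,
        Real.mul_rpow (by positivity) (by positivity)]
      gcongr
      exact Real.rpow_le_self_of_le_one (by positivity)
        (pow_le_one₀ (by norm_num) (by norm_num)) hp
    rw [hhalf, ← ENNReal.ofReal_mul (by positivity)]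
    simp only [hf]
    split_ifs
    · exact ENNReal.ofReal_le_ofReal hle
    · exact zero_le
  calc ∑' k, f k = ∑' n : ℕ, f (K - n) := (hinj.tsum_eq hsupp).symm
    _ ≤ ∑' n : ℕ, ENNReal.ofReal (|a - b| ^ p) * 2⁻¹ ^ n := ENNReal.tsum_le_tsum hterm
    _ = 2 * ENNReal.ofReal (|a - b| ^ p) := by
        rw [ENNReal.tsum_mul_left, ENNReal.tsum_geometric, ENNReal.one_sub_inv_two, inv_inv,
          mul_comm]

/-- For `N ≥ 1`, `p > 1`, `s ∈ (0,1)` with `N > sp` there is `C = C(N,p,s) > 0` such that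
for every bounded, compactly supported measurable `u : ℝ^N → ℝ`, setting
`a_k := |{|u| > 2^k}|`, one has
`C Σ_{k∈ℤ, a_k ≠ 0} a_{k+1} a_k^{-sp/N} 2^{kp} ≤ [u]_{s,p}^p`. -/
theorem levelset_sum_le_gagliardo
    (N : ℕ) (hN : 1 ≤ N) (p s : ℝ) (hp : 1 < p) (hs : s ∈ Set.Ioo (0 : ℝ) 1)
    (hNs : s * p < N) :
    ∃ C : ℝ, 0 < C ∧
      ∀ u : EuclideanSpace ℝ (Fin N) → ℝ, Measurable u → (∃ M : ℝ, ∀ x, |u x| ≤ M) →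
        HasCompactSupport u →
        ENNReal.ofReal C *
            ∑' k : ℤ,
              (if volume {x | (2 : ℝ) ^ k < |u x|} ≠ 0 then
                volume {x | (2 : ℝ) ^ (k + 1) < |u x|} *
                  volume {x | (2 : ℝ) ^ k < |u x|} ^ (-(s * p) / (N : ℝ)) *
                  ENNReal.ofReal (((2 : ℝ) ^ k) ^ p)
              else 0) ≤
          ∫⁻ x, ∫⁻ y,
            ENNReal.ofReal (|u x - u y| ^ p / ‖x - y‖ ^ ((N : ℝ) + s * p)) := by
  have hσ : 0 ≤ s * p := mul_nonneg hs.1.le (by linarith)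
  obtain ⟨c, hc, hlower⟩ := exists_const_mul_volume_rpow_le_lintegral_compl N hN (s * p) hσ
  refine ⟨2⁻¹ * c, by positivity, fun u hu _ hsupp => ?_⟩
  set A : ℤ → Set (EuclideanSpace ℝ (Fin N)) := fun k => {x | (2 : ℝ) ^ k < |u x|} with hA
  have hAmeas : ∀ k, MeasurableSet (A k) := fun k =>
    measurableSet_lt measurable_const (by fun_prop)
  have hAfin : ∀ k, volume (A k) ≠ ⊤ := fun k => by
    refine ((measure_mono fun x hx => ?_).trans_lt (IsCompact.measure_lt_top hsupp)).ne
    refine subset_tsupport u fun h => ?_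
    have hx' : (2 : ℝ) ^ k < |u x| := hx
    rw [h, abs_zero] at hx'
    exact absurd hx' (by positivity : (0 : ℝ) < 2 ^ k).not_gt
  have hAanti : ∀ k, A (k + 1) ⊆ A k := fun k x hx => by
    have hx' : (2 : ℝ) ^ (k + 1) < |u x| := hx
    exact lt_of_le_of_lt (zpow_le_zpow_right₀ one_le_two (Int.le_add_one le_rfl)) hx'
  set w : ℤ → ENNReal := fun k => ENNReal.ofReal (((2 : ℝ) ^ k) ^ p) with hw
  set κ : EuclideanSpace ℝ (Fin N) → EuclideanSpace ℝ (Fin N) → ENNReal :=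
    fun x y => ENNReal.ofReal (1 / ‖x - y‖ ^ ((N : ℝ) + s * p)) with hκ
  have hκmeas : Measurable (Function.uncurry κ) := by
    simp only [hκ, Function.uncurry_def]
    fun_prop
  set F : ℤ → EuclideanSpace ℝ (Fin N) → EuclideanSpace ℝ (Fin N) → ENNReal := fun k x y =>
    (A (k + 1) ×ˢ (A k)ᶜ).indicator (fun z => w k * κ z.1 z.2) (x, y) with hF
  have hFmeas : ∀ k, Measurable (Function.uncurry (F k)) := fun k =>
    (hκmeas.const_mul (w k)).indicator ((hAmeas _).prod (hAmeas _).compl)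
  have hlevel : ∀ k, ENNReal.ofReal c * (if volume (A k) ≠ 0 then
      volume (A (k + 1)) * volume (A k) ^ (-(s * p) / (N : ℝ)) * w k else 0) ≤
      ∫⁻ x, ∫⁻ y, F k x y := fun k => by
    split_ifs with h0
    swap
    · simp
    calc ENNReal.ofReal c * (volume (A (k + 1)) * volume (A k) ^ (-(s * p) / (N : ℝ)) * w k)
        = ∫⁻ _ in A (k + 1),
            w k * (ENNReal.ofReal c * volume (A k) ^ (-(s * p) / (N : ℝ))) := by
          rw [setLIntegral_const]
          ring
      _ ≤ ∫⁻ x in A (k + 1), ∫⁻ y, F k x y := by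
          refine setLIntegral_mono' (hAmeas _) fun x hx => ?_
          calc w k * (ENNReal.ofReal c * volume (A k) ^ (-(s * p) / (N : ℝ)))
              ≤ w k * ∫⁻ y in (A k)ᶜ, κ x y := by
                gcongr
                exact hlower (A k) x (hAmeas k) (hAanti k hx) h0 (hAfin k)
            _ = ∫⁻ y in (A k)ᶜ, w k * κ x y :=
                (lintegral_const_mul' _ _ ENNReal.ofReal_ne_top).symm
            _ = ∫⁻ y, F k x y := by
                rw [← lintegral_indicator (hAmeas k).compl]
                refine lintegral_congr fun y => ?_
                by_cases hy : y ∈ (A k)ᶜ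
                · simp only [hF]
                  rw [Set.indicator_of_mem hy, Set.indicator_of_mem (Set.mk_mem_prod hx hy)]
                · simp only [hF]
                  rw [Set.indicator_of_notMem hy, Set.indicator_of_notMem fun h => hy h.2]
      _ ≤ ∫⁻ x, ∫⁻ y, F k x y := setLIntegral_le_lintegral _ _
  have hpoint : ∀ x y, ∑' k, F k x y ≤
      2 * ENNReal.ofReal (|u x - u y| ^ p / ‖x - y‖ ^ ((N : ℝ) + s * p)) := fun x y => by
    have hFk : ∀ k, F k x y = (if (2 : ℝ) ^ (k + 1) < |u x| ∧ |u y| ≤ (2 : ℝ) ^ k then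
        w k else 0) * κ x y := fun k => by
      simp [hF, hA, Set.indicator_apply, ite_mul]
    calc ∑' k, F k x y
        ≤ 2 * ENNReal.ofReal (|(|u x| - |u y|)| ^ p) * κ x y := by
          simp_rw [hFk]
          rw [ENNReal.tsum_mul_right]
          gcongr
          exact tsum_dyadic_between_le p hp.le _ _
      _ ≤ 2 * ENNReal.ofReal (|u x - u y| ^ p) * κ x y := by
          gcongr 2 * ENNReal.ofReal (?_ ^ p) * _
          exact abs_abs_sub_abs_le_abs_sub _ _
      _ = 2 * ENNReal.ofReal (|u x - u y| ^ p / ‖x - y‖ ^ ((N : ℝ) + s * p)) := by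
          rw [mul_assoc, ← ENNReal.ofReal_mul (by positivity), mul_one_div]
  have hsum : ENNReal.ofReal c * ∑' k, (if volume (A k) ≠ 0 then
      volume (A (k + 1)) * volume (A k) ^ (-(s * p) / (N : ℝ)) * w k else 0) ≤
      2 * ∫⁻ x, ∫⁻ y,
        ENNReal.ofReal (|u x - u y| ^ p / ‖x - y‖ ^ ((N : ℝ) + s * p)) := by
    calc _ ≤ ∑' k, ∫⁻ x, ∫⁻ y, F k x y := by
          rw [← ENNReal.tsum_mul_left]
          exact ENNReal.tsum_le_tsum hlevel
      _ = ∫⁻ x, ∫⁻ y, ∑' k, F k x y := by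
          have hinner : ∀ k, Measurable fun x => ∫⁻ y, F k x y := fun k =>
            (hFmeas k).lintegral_prod_right'
          rw [← lintegral_tsum fun k => (hinner k).aemeasurable]
          refine lintegral_congr fun x => ?_
          exact (lintegral_tsum fun k =>
            ((hFmeas k).comp measurable_prodMk_left).aemeasurable).symm
      _ ≤ ∫⁻ x, ∫⁻ y, 2 *
            ENNReal.ofReal (|u x - u y| ^ p / ‖x - y‖ ^ ((N : ℝ) + s * p)) :=
          lintegral_mono fun x => lintegral_mono (hpoint x)
      _ = _ := by
          simp_rw [lintegral_const_mul' _ _ ENNReal.ofNat_ne_top]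
  rw [ENNReal.ofReal_mul (by norm_num), ENNReal.ofReal_inv_of_pos two_pos, ENNReal.ofReal_ofNat,
    mul_assoc, ENNReal.inv_mul_le_iff two_ne_zero ENNReal.ofNat_ne_top]
  exact hsum
end

section
/- (Fractional Sobolev inequality, Euclidean case of the paper's main Sobolev theorem.) Let N ≥ 1, p > 1, s ∈ (0,1) with N > sp, and set p* = Np/(N − sp). Then there exists a constant C = C(N,p,s) > 0 such that for every measurable, compactly supported function u : ℝ^N → ℝ one has ‖u‖_{L^{p*}(ℝ^N)}^p ≤ C [u]_{s,p}^p. -/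
open MeasureTheory

/-- By Chebyshev's inequality, if the `q`-th power of the `L^q` norm of `u` is at most `J`, then
`|u| ≤ t / 2` on at least half of any ball of volume `2 * J / (t / 2) ^ q`. -/
theorem volume_ball_inter_abs_le_half {E : Type*} [NormedAddCommGroup E] [MeasureSpace E]
    {u : E → ℝ} (hu : Measurable u) {q J t V : ℝ} (hq : 0 < q) (ht : 0 < t)
    (hI : ∫⁻ x, ENNReal.ofReal (|u x| ^ q) ≤ ENNReal.ofReal J) {x : E} {r : ℝ}
    (hball : volume (Metric.ball x r) = ENNReal.ofReal (2 * V)) (hJ : 0 ≤ J)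
    (hV : V = J / (t / 2) ^ q) :
    ENNReal.ofReal V ≤ volume (Metric.ball x r ∩ {y | |u y| ≤ t / 2}) := by
  have htq : 0 < (t / 2) ^ q := by positivity
  have hV0 : 0 ≤ V := by rw [hV]; positivity
  have hcheb : volume {y | t / 2 < |u y|} ≤ ENNReal.ofReal V := by
    have h1 := mul_meas_ge_le_lintegral₀ (μ := volume)
      (f := fun y => ENNReal.ofReal (|u y| ^ q)) (by fun_prop) (ENNReal.ofReal ((t / 2) ^ q))
    have h2 : volume {y | t / 2 < |u y|} ≤
        volume {y | ENNReal.ofReal ((t / 2) ^ q) ≤ ENNReal.ofReal (|u y| ^ q)} := by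
      refine measure_mono fun y hy => ENNReal.ofReal_le_ofReal ?_
      exact Real.rpow_le_rpow (by positivity) (le_of_lt hy) hq.le
    rw [hV, ENNReal.ofReal_div_of_pos htq, ENNReal.le_div_iff_mul_le
      (Or.inl (by simpa using htq)) (Or.inl ENNReal.ofReal_ne_top), mul_comm]
    exact (mul_le_mul_right h2 _).trans (h1.trans hI)
  have hsplit : volume (Metric.ball x r) ≤
      volume (Metric.ball x r ∩ {y | |u y| ≤ t / 2}) + volume {y | t / 2 < |u y|} := by
    refine (measure_mono fun y hy => ?_).trans (measure_union_le _ _)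
    rcases le_or_gt (|u y|) (t / 2) with h | h
    · exact Or.inl ⟨hy, h⟩
    · exact Or.inr h
  have h3 := hsplit.trans (add_le_add_right hcheb _)
  rw [hball, two_mul, ENNReal.ofReal_add hV0 hV0] at h3
  exact (ENNReal.add_le_add_iff_right ENNReal.ofReal_ne_top).1 h3

/-- Pointwise lower bound for the fractional energy density in terms of an upper bound `J` for
the `q`-th power of the `L^q` norm, where `q` is the critical exponent. -/
theorem exists_pos_rpow_le_lintegral_gagliardo
    (N : ℕ) (hN : 1 ≤ N) (p s q : ℝ) (hp : 1 < p) (hs : 0 < s)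
    (hq : 0 < q) (hpq : p + q * (s * p / N) = q) :
    ∃ c : ℝ, 0 < c ∧ ∀ u : EuclideanSpace ℝ (Fin N) → ℝ, Measurable u → ∀ J : ℝ, 0 < J →
      ∫⁻ x, ENNReal.ofReal (|u x| ^ q) ≤ ENNReal.ofReal J → ∀ x,
        ENNReal.ofReal (c * J ^ (-(s * p / N)) * |u x| ^ q) ≤
          ∫⁻ y, ENNReal.ofReal (|u x - u y| ^ p / ‖x - y‖ ^ ((N : ℝ) + s * p)) := by
  have hN0 : (0 : ℝ) < N := by exact_mod_cast hN
  have : Nonempty (Fin N) := ⟨⟨0, hN⟩⟩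
  set ω : ℝ := (volume (Metric.ball (0 : EuclideanSpace ℝ (Fin N)) 1)).toReal with hω
  have hωtop : volume (Metric.ball (0 : EuclideanSpace ℝ (Fin N)) 1) ≠ ⊤ :=
    measure_ball_lt_top.ne
  have hω0 : 0 < ω :=
    ENNReal.toReal_pos (Metric.measure_ball_pos volume _ one_pos).ne' hωtop
  set a : ℝ := s * p / N with ha
  refine ⟨2⁻¹ ^ p * (ω / 2) * (2 * 2 ^ q / ω) ^ (-a), by positivity, ?_⟩
  intro u hu J hJ hI x
  rcases (abs_nonneg (u x)).eq_or_lt with h0 | ht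
  · simp [← h0, Real.zero_rpow hq.ne']
  set t := |u x|
  set K : ℝ := 2 * 2 ^ q / ω * J * t ^ (-q) with hK
  have hK0 : 0 < K := by positivity
  set r : ℝ := K ^ (1 / (N : ℝ)) with hr
  have hr0 : 0 < r := by positivity
  have hrN : r ^ N = K := by
    rw [hr, ← Real.rpow_natCast, ← Real.rpow_mul hK0.le, one_div_mul_cancel hN0.ne', Real.rpow_one]
  have hrsp : r ^ ((N : ℝ) + s * p) = K * K ^ a := by
    rw [hr, ← Real.rpow_mul hK0.le, ← Real.rpow_one_add' hK0.le]
    · congr 1; rw [ha]; field_simp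
    · positivity
  have hVK : J / (t / 2) ^ q = ω / 2 * K := by
    rw [hK, Real.div_rpow ht.le two_pos.le, Real.rpow_neg ht.le]
    have : 0 < t ^ q := by positivity
    field_simp
  have hball : volume (Metric.ball x r) = ENNReal.ofReal (2 * (ω / 2 * K)) := by
    rw [Measure.addHaar_ball volume x hr0.le, finrank_euclideanSpace_fin, hrN,
      ← ENNReal.ofReal_toReal hωtop, ← hω, ← ENNReal.ofReal_mul hK0.le]
    congr 1; ring
  have hvol := volume_ball_inter_abs_le_half hu hq ht hI hball hJ.le hVK.symm
  set S := Metric.ball x r ∩ {y | |u y| ≤ t / 2}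
  have hSm : MeasurableSet S :=
    measurableSet_ball.inter (measurableSet_le (by fun_prop) measurable_const)
  have hden : 0 < K * K ^ a := by positivity
  have hpt : ∀ y ∈ S, ENNReal.ofReal ((t / 2) ^ p / (K * K ^ a)) ≤
      ENNReal.ofReal (|u x - u y| ^ p / ‖x - y‖ ^ ((N : ℝ) + s * p)) := by
    rintro y ⟨hy, hyt⟩
    have hyt' : |u y| ≤ t / 2 := hyt
    have hxy : x ≠ y := by
      rintro rfl
      linarith
    have hn : 0 < ‖x - y‖ := norm_pos_iff.2 (sub_ne_zero.2 hxy)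
    have hnr : ‖x - y‖ ≤ r := by
      rw [Metric.mem_ball, dist_comm, dist_eq_norm] at hy
      exact hy.le
    have hd : t / 2 ≤ |u x - u y| := by
      have := abs_sub_abs_le_abs_sub (u x) (u y)
      linarith
    refine ENNReal.ofReal_le_ofReal ?_
    rw [← hrsp]
    gcongr
  calc ENNReal.ofReal (2⁻¹ ^ p * (ω / 2) * (2 * 2 ^ q / ω) ^ (-a) * J ^ (-a) * t ^ q)
      = ENNReal.ofReal ((t / 2) ^ p / (K * K ^ a)) * ENNReal.ofReal (ω / 2 * K) := by
        rw [← ENNReal.ofReal_mul (by positivity)]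
        congr 1
        have h1 : (K ^ a)⁻¹ = (2 * 2 ^ q / ω) ^ (-a) * J ^ (-a) * t ^ (q * a) := by
          rw [← Real.rpow_neg hK0.le, hK, Real.mul_rpow (by positivity) (by positivity),
            Real.mul_rpow (by positivity) hJ.le, ← Real.rpow_mul ht.le, neg_mul_neg]
        have h2 : t ^ q = t ^ p * t ^ (q * a) := by rw [← Real.rpow_add ht, hpq]
        have h3 : (t / 2) ^ p = 2⁻¹ ^ p * t ^ p := by
          rw [div_eq_inv_mul, Real.mul_rpow (by positivity) ht.le]
        have h4 : (t / 2) ^ p / (K * K ^ a) * (ω / 2 * K) =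
            (t / 2) ^ p * (ω / 2) * (K ^ a)⁻¹ := by
          field_simp
        rw [h4, h1, h2, h3]
        ring
    _ ≤ ENNReal.ofReal ((t / 2) ^ p / (K * K ^ a)) * volume S := by gcongr
    _ ≤ ∫⁻ y in S, ENNReal.ofReal (|u x - u y| ^ p / ‖x - y‖ ^ ((N : ℝ) + s * p)) := by
        rw [← setLIntegral_const]
        exact setLIntegral_mono' hSm hpt
    _ ≤ _ := setLIntegral_le_lintegral _ _

/-- The fractional Sobolev inequality for functions whose `L^q` norm is known to be finite. -/
theorem exists_pos_mul_rpow_lintegral_le_gagliardo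
    (N : ℕ) (hN : 1 ≤ N) (p s q : ℝ) (hp : 1 < p) (hs : 0 < s)
    (hq : 0 < q) (hpq : p + q * (s * p / N) = q) :
    ∃ C : ℝ, 0 < C ∧ ∀ u : EuclideanSpace ℝ (Fin N) → ℝ, Measurable u →
      ∫⁻ x, ENNReal.ofReal (|u x| ^ q) ≠ ⊤ →
        (∫⁻ x, ENNReal.ofReal (|u x| ^ q)) ^ (p / q) ≤ ENNReal.ofReal C *
          ∫⁻ x, ∫⁻ y, ENNReal.ofReal (|u x - u y| ^ p / ‖x - y‖ ^ ((N : ℝ) + s * p)) := by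
  obtain ⟨c, hc, h⟩ := exists_pos_rpow_le_lintegral_gagliardo N hN p s q hp hs hq hpq
  refine ⟨c⁻¹, by positivity, fun u hu hfin => ?_⟩
  have hpq0 : 0 < p / q := by positivity
  set I := ∫⁻ x, ENNReal.ofReal (|u x| ^ q) with hI
  rcases eq_or_ne I 0 with h0 | h0
  · rw [h0, ENNReal.zero_rpow_of_pos hpq0]
    exact zero_le
  have hJ : 0 < I.toReal := ENNReal.toReal_pos h0 hfin
  have hIJ : I = ENNReal.ofReal I.toReal := (ENNReal.ofReal_toReal hfin).symm
  have hexp : p / q = -(s * p / N) + 1 := by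
    rw [div_eq_iff hq.ne']; linarith
  have key : ENNReal.ofReal (c * I.toReal ^ (-(s * p / N))) * I ≤
      ∫⁻ x, ∫⁻ y, ENNReal.ofReal (|u x - u y| ^ p / ‖x - y‖ ^ ((N : ℝ) + s * p)) := by
    rw [hI, ← lintegral_const_mul _ (by fun_prop), ← hI]
    refine lintegral_mono fun x => ?_
    rw [← ENNReal.ofReal_mul (by positivity)]
    exact h u hu _ hJ hIJ.le x
  refine le_trans (le_of_eq ?_) (mul_le_mul_right key _)
  nth_rewrite 3 [hIJ]
  nth_rewrite 1 [hIJ]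
  rw [ENNReal.ofReal_rpow_of_pos hJ, ← ENNReal.ofReal_mul (by positivity),
    ← ENNReal.ofReal_mul (by positivity), hexp, Real.rpow_add hJ, Real.rpow_one]
  congr 1
  field_simp

/-- Fractional Sobolev inequality: for `N ≥ 1`, `p > 1`, `s ∈ (0,1)` with `N > sp` and
`p* = Np/(N - sp)`, there exists `C = C(N,p,s) > 0` such that for every measurable
compactly supported `u : ℝ^N → ℝ`, `‖u‖_{L^{p*}}^p ≤ C [u]_{s,p}^p`. -/
theorem fractional_sobolev_inequality
    (N : ℕ) (hN : 1 ≤ N) (p s : ℝ) (hp : 1 < p) (hs : s ∈ Set.Ioo (0 : ℝ) 1)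
    (hNs : s * p < N) :
    ∃ C : ℝ, 0 < C ∧
      ∀ u : EuclideanSpace ℝ (Fin N) → ℝ, Measurable u → HasCompactSupport u →
        ((∫⁻ x, ENNReal.ofReal (|u x| ^ ((N : ℝ) * p / ((N : ℝ) - s * p)))) ^
            (1 / ((N : ℝ) * p / ((N : ℝ) - s * p)))) ^ p ≤
          ENNReal.ofReal C *
            ∫⁻ x, ∫⁻ y,
              ENNReal.ofReal (|u x - u y| ^ p / ‖x - y‖ ^ ((N : ℝ) + s * p)) := by
  obtain ⟨hs0, -⟩ := hs
  have hN0 : (0 : ℝ) < N := by exact_mod_cast hN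
  have hd : 0 < (N : ℝ) - s * p := sub_pos.2 hNs
  set q : ℝ := (N : ℝ) * p / ((N : ℝ) - s * p)
  have hq : 0 < q := by positivity
  have hpq : p + q * (s * p / N) = q := by
    have hqd : q * ((N : ℝ) - s * p) = N * p := div_mul_cancel₀ _ hd.ne'
    rw [mul_div_assoc', ← eq_sub_iff_add_eq', div_eq_iff hN0.ne']
    linear_combination -hqd
  have hpq0 : 0 < p / q := by positivity
  obtain ⟨C, hC, h⟩ :=
    exists_pos_mul_rpow_lintegral_le_gagliardo N hN p s q hp hs0 hq hpq
  refine ⟨C, hC, fun u hu hsupp => ?_⟩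
  rw [← ENNReal.rpow_mul, one_div_mul_eq_div, ← ENNReal.le_rpow_inv_iff hpq0]
  set D := ENNReal.ofReal C *
    ∫⁻ x, ∫⁻ y, ENNReal.ofReal (|u x - u y| ^ p / ‖x - y‖ ^ ((N : ℝ) + s * p)) with hD
  have htrunc : ∀ n : ℕ, ∫⁻ x, ENNReal.ofReal (|min |u x| n| ^ q) ≤ D ^ (p / q)⁻¹ := by
    intro n
    rw [ENNReal.le_rpow_inv_iff hpq0]
    refine (h (fun x => min |u x| n) (by fun_prop) ?_).trans ?_
    · have hle : ∀ x, ENNReal.ofReal (|min |u x| n| ^ q) ≤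
          (tsupport u).indicator (fun _ => ENNReal.ofReal ((n : ℝ) ^ q)) x := by
        intro x
        by_cases hx : x ∈ tsupport u
        · rw [Set.indicator_of_mem hx, abs_of_nonneg (by positivity)]
          gcongr
          exact min_le_right _ _
        · simp [image_eq_zero_of_notMem_tsupport hx, Real.zero_rpow hq.ne']
      refine ((lintegral_mono hle).trans_lt ?_).ne
      rw [lintegral_indicator_const (isClosed_tsupport u).measurableSet]
      exact ENNReal.mul_lt_top ENNReal.ofReal_lt_top hsupp.isCompact.measure_lt_top
    · rw [hD]
      refine mul_le_mul_right (lintegral_mono fun x => lintegral_mono fun y => ?_) _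
      refine ENNReal.ofReal_le_ofReal (div_le_div_of_nonneg_right
        (Real.rpow_le_rpow (abs_nonneg _) ?_ (by positivity)) (by positivity))
      calc |min |u x| (n : ℝ) - min |u y| n| ≤ |(|u x| - |u y|)| := by
            simpa using abs_min_sub_min_le_max |u x| (n : ℝ) |u y| n
        _ ≤ |u x - u y| := abs_abs_sub_abs_le_abs_sub _ _
  calc ∫⁻ x, ENNReal.ofReal (|u x| ^ q)
      ≤ ∫⁻ x, Filter.liminf (fun n : ℕ => ENNReal.ofReal (|min |u x| n| ^ q)) Filter.atTop := by
        refine lintegral_mono fun x => (Filter.Tendsto.liminf_eq ?_).ge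
        refine tendsto_const_nhds.congr' ?_
        filter_upwards [Filter.eventually_ge_atTop ⌈|u x|⌉₊] with n hn
        rw [min_eq_left (Nat.ceil_le.1 hn), abs_abs]
    _ ≤ Filter.liminf (fun n : ℕ => ∫⁻ x, ENNReal.ofReal (|min |u x| n| ^ q)) Filter.atTop :=
        lintegral_liminf_le fun n => by fun_prop
    _ ≤ D ^ (p / q)⁻¹ :=
        Filter.liminf_le_of_frequently_le' (Filter.Frequently.of_forall htrunc)
end

section
/- (Pointwise Picone-type inequality.) Let p > 1, let a, b ∈ ℝ, and let w₁, w₂ be positive real numbers. Then |a − b|^p ≥ ( |a/w₁|^p · w₁ − |b/w₂|^p · w₂ ) · |w₁ − w₂|^{p−2} (w₁ − w₂). Equivalently, with g₁ = a/w₁ and g₂ = b/w₂: |a − b|^p − ( |g₁|^p w₁ − |g₂|^p w₂ ) |w₁ − w₂|^{p−2} (w₁ − w₂) ≥ 0. -/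
/-- Convexity of the perspective `(t, w) ↦ |t / w| ^ p * w` of `|·| ^ p`, as subadditivity. -/
theorem abs_div_rpow_mul_add_le {p : ℝ} (hp : 1 ≤ p) (s t : ℝ) {u v : ℝ}
    (hu : 0 < u) (hv : 0 < v) :
    |(s + t) / (u + v)| ^ p * (u + v) ≤ |s / u| ^ p * u + |t / v| ^ p * v := by
  have huv : 0 < u + v := add_pos hu hv
  have hconv := (convexOn_rpow hp).2 (Set.mem_Ici.mpr (abs_nonneg (s / u)))
    (Set.mem_Ici.mpr (abs_nonneg (t / v))) (div_pos hu huv).le (div_pos hv huv).le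
    (by rw [← add_div, div_self huv.ne'])
  simp only [smul_eq_mul] at hconv
  have habs : |(s + t) / (u + v)| ≤ u / (u + v) * |s / u| + v / (u + v) * |t / v| := by
    calc |(s + t) / (u + v)| = |u / (u + v) * (s / u) + v / (u + v) * (t / v)| := by
          congr 1
          field_simp
      _ ≤ |u / (u + v) * (s / u)| + |v / (u + v) * (t / v)| := abs_add_le _ _
      _ = _ := by rw [abs_mul, abs_mul, abs_of_pos (div_pos hu huv), abs_of_pos (div_pos hv huv)]
  calc |(s + t) / (u + v)| ^ p * (u + v)
      ≤ (u / (u + v) * |s / u| ^ p + v / (u + v) * |t / v| ^ p) * (u + v) := by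
        gcongr
        exact (Real.rpow_le_rpow (abs_nonneg _) habs (by linarith)).trans hconv
    _ = _ := by field_simp

/-- The pointwise Picone inequality when the first weight is the larger one. -/
theorem picone_of_lt {p : ℝ} (hp : 1 < p) (a b : ℝ) {w₁ w₂ : ℝ} (hw₂ : 0 < w₂) (h : w₂ < w₁) :
    (|a / w₁| ^ p * w₁ - |b / w₂| ^ p * w₂) * (|w₁ - w₂| ^ (p - 2) * (w₁ - w₂)) ≤
      |a - b| ^ p := by
  have hd : 0 < w₁ - w₂ := sub_pos.mpr h
  have hsub := abs_div_rpow_mul_add_le hp.le (a - b) b hd hw₂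
  rw [sub_add_cancel, sub_add_cancel, ← sub_le_iff_le_add] at hsub
  rw [abs_of_pos hd]
  refine (mul_le_mul_of_nonneg_right hsub (by positivity)).trans_eq ?_
  have hpow : (w₁ - w₂) * ((w₁ - w₂) ^ (p - 2) * (w₁ - w₂)) = (w₁ - w₂) ^ p := by
    rw [Real.rpow_sub hd, Real.rpow_two]
    field_simp
  rw [mul_assoc, hpow, abs_div, abs_of_pos hd, Real.div_rpow (abs_nonneg _) hd.le,
    div_mul_cancel₀ _ (Real.rpow_pos_of_pos hd p).ne']


/-- Pointwise Picone-type inequality: for `p > 1`, reals `a, b` and positive reals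
`w₁, w₂`, writing `g₁ = a / w₁` and `g₂ = b / w₂`, one has
`|a - b|^p - (|g₁|^p * w₁ - |g₂|^p * w₂) * |w₁ - w₂|^(p-2) * (w₁ - w₂) ≥ 0`.
Here `|w₁ - w₂|^(p-2) * (w₁ - w₂)` is the odd power (equal to `0` when `w₁ = w₂`,
by the convention `(0:ℝ) ^ (negative real) = 0` for `Real.rpow`). -/
theorem pointwise_picone_inequality
    (p : ℝ) (hp : 1 < p) (a b w₁ w₂ : ℝ) (hw₁ : 0 < w₁) (hw₂ : 0 < w₂) :
    0 ≤ |a - b| ^ p -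
      (|a / w₁| ^ p * w₁ - |b / w₂| ^ p * w₂) * (|w₁ - w₂| ^ (p - 2) * (w₁ - w₂)) := by
  rcases lt_trichotomy w₁ w₂ with h | rfl | h
  · have key := picone_of_lt hp b a hw₁ h
    rw [abs_sub_comm b a, abs_sub_comm w₂ w₁] at key
    linarith
  · simpa using Real.rpow_nonneg (abs_nonneg (a - b)) p
  · exact sub_nonneg.mpr (picone_of_lt hp a b hw₂ h)
end

section
/- (Picone-type integral inequality, Euclidean case.) Let N ≥ 1, p > 1, s ∈ (0,1), and let Ω ⊂ ℝ^N be a measurable set. Let ω : Ω → ℝ be measurable with ω > 0 on Ω, and let u : Ω → ℝ be measurable. Write k(x,y) = |x − y|^{−(N+sp)}. Assume that the double integral ∫_Ω ∫_Ω |u(x) − u(y)|^p k(x,y) dx dy is finite and that the function (x,y) ↦ ( |u(x)|^p/ω(x)^{p−1} − |u(y)|^p/ω(y)^{p−1} ) |ω(x) − ω(y)|^{p−2} (ω(x) − ω(y)) k(x,y) is integrable on Ω × Ω. Then (1/2) ∫_Ω ∫_Ω |u(x) − u(y)|^p k(x,y) dx dy ≥ (1/2) ∫_Ω ∫_Ω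 ( |u(x)|^p/ω(x)^{p−1} − |u(y)|^p/ω(y)^{p−1} ) |ω(x) − ω(y)|^{p−2} (ω(x) − ω(y)) k(x,y) dx dy. -/
open MeasureTheory

/-- Two-term Radon inequality. -/
theorem add_rpow_div_add_rpow_le {p a b x y : ℝ} (hp : 1 ≤ p) (ha : 0 ≤ a) (hb : 0 ≤ b)
    (hx : 0 < x) (hy : 0 < y) :
    (a + b) ^ p / (x + y) ^ (p - 1) ≤ a ^ p / x ^ (p - 1) + b ^ p / y ^ (p - 1) := by
  have hxy : 0 < x + y := add_pos hx hy
  have perspective {c z : ℝ} (hc : 0 ≤ c) (hz : 0 < z) :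
      c ^ p / z ^ (p - 1) = z * (c / z) ^ p := by
    rw [Real.div_rpow hc hz.le, Real.rpow_sub_one hz.ne']
    field_simp
  have h := (convexOn_rpow hp).2 (div_nonneg ha hx.le : a / x ∈ Set.Ici 0)
    (div_nonneg hb hy.le : b / y ∈ Set.Ici 0) (div_nonneg hx.le hxy.le)
    (div_nonneg hy.le hxy.le) (by field_simp)
  simp only [smul_eq_mul] at h
  have hmean : x / (x + y) * (a / x) + y / (x + y) * (b / y) = (a + b) / (x + y) := by
    field_simp
  rw [hmean] at h
  rw [perspective (add_nonneg ha hb) hxy, perspective ha hx, perspective hb hy]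
  calc (x + y) * ((a + b) / (x + y)) ^ p
      ≤ (x + y) * (x / (x + y) * (a / x) ^ p + y / (x + y) * (b / y) ^ p) := by gcongr
    _ = x * (a / x) ^ p + y * (b / y) ^ p := by field_simp

theorem discrete_picone_of_lt {p a b x y : ℝ} (hp : 1 ≤ p) (hy : 0 < y) (hyx : y < x) :
    (|a| ^ p / x ^ (p - 1) - |b| ^ p / y ^ (p - 1)) * (|x - y| ^ (p - 2) * (x - y)) ≤
      |a - b| ^ p := by
  have ht : 0 < x - y := sub_pos.2 hyx
  have htri : |a| ≤ |a - b| + |b| := by simpa using abs_add_le (a - b) b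
  have hradon := add_rpow_div_add_rpow_le hp (abs_nonneg (a - b)) (abs_nonneg b) ht hy
  rw [sub_add_cancel] at hradon
  have hmono : |a| ^ p / x ^ (p - 1) ≤ (|a - b| + |b|) ^ p / x ^ (p - 1) := by
    have := hy.trans hyx
    gcongr
  have hpow : |x - y| ^ (p - 2) * (x - y) = (x - y) ^ (p - 1) := by
    rw [abs_of_pos ht, ← Real.rpow_add_one ht.ne']
    congr 1
    ring
  rw [hpow, ← le_div_iff₀ (Real.rpow_pos_of_pos ht _)]
  linarith

/-- Discrete Picone inequality. -/
theorem discrete_picone {p x y : ℝ} (hp : 1 < p) (a b : ℝ) (hx : 0 < x) (hy : 0 < y) :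
    (|a| ^ p / x ^ (p - 1) - |b| ^ p / y ^ (p - 1)) * (|x - y| ^ (p - 2) * (x - y)) ≤
      |a - b| ^ p := by
  rcases lt_trichotomy x y with h | rfl | h
  · have := discrete_picone_of_lt (a := b) (b := a) hp.le hx h
    rw [abs_sub_comm y x, abs_sub_comm b a] at this
    linarith
  · simpa using Real.rpow_nonneg (abs_nonneg (a - b)) p
  · exact discrete_picone_of_lt hp.le hy h

/-- Picone-type integral inequality (Euclidean case): for a measurable set `Ω ⊆ ℝ^N`,
measurable `ω > 0` on `Ω`, measurable `u`, and kernel `k(x,y) = |x - y|^{-(N+sp)}`,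
assuming the relevant integrands are integrable on `Ω × Ω`, one has
`(1/2) ∫∫ (|u(x)|^p/ω(x)^{p-1} - |u(y)|^p/ω(y)^{p-1}) |ω(x)-ω(y)|^{p-2} (ω(x)-ω(y)) k(x,y)
  ≤ (1/2) ∫∫ |u(x)-u(y)|^p k(x,y)`. -/
theorem picone_integral_inequality
    (N : ℕ) (hN : 1 ≤ N) (p s : ℝ) (hp : 1 < p) (hs : s ∈ Set.Ioo (0 : ℝ) 1)
    (Ω : Set (EuclideanSpace ℝ (Fin N))) (hΩ : MeasurableSet Ω)
    (ω u : EuclideanSpace ℝ (Fin N) → ℝ)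
    (hω : Measurable ω) (hu : Measurable u) (hωpos : ∀ x ∈ Ω, 0 < ω x)
    (h1 : Integrable
      (fun z : EuclideanSpace ℝ (Fin N) × EuclideanSpace ℝ (Fin N) =>
        |u z.1 - u z.2| ^ p * ‖z.1 - z.2‖ ^ (-((N : ℝ) + s * p)))
      ((volume.restrict Ω).prod (volume.restrict Ω)))
    (h2 : Integrable
      (fun z : EuclideanSpace ℝ (Fin N) × EuclideanSpace ℝ (Fin N) =>
        (|u z.1| ^ p / ω z.1 ^ (p - 1) - |u z.2| ^ p / ω z.2 ^ (p - 1)) *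
          (|ω z.1 - ω z.2| ^ (p - 2) * (ω z.1 - ω z.2)) *
          ‖z.1 - z.2‖ ^ (-((N : ℝ) + s * p)))
      ((volume.restrict Ω).prod (volume.restrict Ω))) :
    (1 / 2) *
        ∫ z : EuclideanSpace ℝ (Fin N) × EuclideanSpace ℝ (Fin N),
          (|u z.1| ^ p / ω z.1 ^ (p - 1) - |u z.2| ^ p / ω z.2 ^ (p - 1)) *
            (|ω z.1 - ω z.2| ^ (p - 2) * (ω z.1 - ω z.2)) *
            ‖z.1 - z.2‖ ^ (-((N : ℝ) + s * p))
          ∂((volume.restrict Ω).prod (volume.restrict Ω)) ≤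
      (1 / 2) *
        ∫ z : EuclideanSpace ℝ (Fin N) × EuclideanSpace ℝ (Fin N),
          |u z.1 - u z.2| ^ p * ‖z.1 - z.2‖ ^ (-((N : ℝ) + s * p))
          ∂((volume.restrict Ω).prod (volume.restrict Ω)) := by
  refine mul_le_mul_of_nonneg_left (integral_mono_ae h2 h1 ?_) (by norm_num)
  rw [Measure.prod_restrict]
  filter_upwards [ae_restrict_mem (hΩ.prod hΩ)] with z hz
  exact mul_le_mul_of_nonneg_right
    (discrete_picone hp (u z.1) (u z.2) (hωpos _ hz.1) (hωpos _ hz.2))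
    (Real.rpow_nonneg (norm_nonneg _) _)
end

section
/- (Fractional p-Laplacian of a power of the norm, Euclidean case.) Let N ≥ 1, p > 1, s ∈ (0,1) with N > sp, and let γ ∈ (0, (N − ps)/(p − 1)). Define f : ℝ^N \ {0} → ℝ by f(z) = |z|^{−γ}. Then there exists a constant μ = μ(γ) > 0 (depending on N, p, s, γ) such that for almost every x ∈ ℝ^N \ {0}, 2 lim_{δ → 0+} ∫_{{y ∈ ℝ^N : |y − x| > δ}} |f(x) − f(y)|^{p−2} (f(x) − f(y)) |x − y|^{−(N+sp)} dy = μ(γ) |x|^{−(ps + γ(p−1))}. -/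
open MeasureTheory

namespace FracPLaplacianPower

open Set Filter Topology Module EuclideanGeometry

variable {E : Type*} [NormedAddCommGroup E]

/-- The punctured open unit ball. -/
def puncturedBall (E : Type*) [NormedAddCommGroup E] : Set E := {y | y ≠ 0 ∧ ‖y‖ < 1}

lemma one_sub_rpow_le {t γ : ℝ} (ht : 0 ≤ t) (ht1 : t ≤ 1) :
    1 - t ^ γ ≤ max 1 γ * (1 - t) := by
  rcases ht.eq_or_lt with rfl | ht0
  · have := Real.rpow_nonneg le_rfl γ
    have := le_max_left 1 γ
    linarith
  have h1 : t ^ max 1 γ ≤ t ^ γ := Real.rpow_le_rpow_of_exponent_ge ht0 ht1 (le_max_right _ _)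
  have h2 := one_add_mul_self_le_rpow_one_add (s := t - 1) (by linarith) (le_max_left 1 γ)
  rw [add_sub_cancel] at h2
  linarith

lemma one_sub_norm_le {e y : E} (he : ‖e‖ = 1) : 1 - ‖y‖ ≤ ‖e - y‖ := by
  have := norm_sub_norm_le e y
  rwa [he] at this

lemma norm_sub_pos {e y : E} (he : ‖e‖ = 1) (hy : y ∈ puncturedBall E) : 0 < ‖e - y‖ :=
  (sub_pos.2 hy.2).trans_le (one_sub_norm_le he)

lemma one_sub_rpow_pos {γ : ℝ} (hγ : 0 < γ) {y : E} (hy : y ∈ puncturedBall E) :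
    0 < 1 - ‖y‖ ^ γ :=
  sub_pos.2 (Real.rpow_lt_one (norm_nonneg _) hy.2 hγ)

lemma one_sub_rpow_norm_le (γ : ℝ) {e y : E} (he : ‖e‖ = 1) (hy : y ∈ puncturedBall E) :
    1 - ‖y‖ ^ γ ≤ max 1 γ * ‖e - y‖ :=
  (one_sub_rpow_le (norm_nonneg y) hy.2.le).trans
    (mul_le_mul_of_nonneg_left (one_sub_norm_le he) (by positivity))

variable [InnerProductSpace ℝ E]

/-- The integrand of the fractional `p`-Laplacian of `‖·‖ ^ (-γ)` at the point `x`. -/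
noncomputable def kernel (p s γ : ℝ) (x y : E) : ℝ :=
  |‖x‖ ^ (-γ) - ‖y‖ ^ (-γ)| ^ (p - 2) * (‖x‖ ^ (-γ) - ‖y‖ ^ (-γ)) *
    ‖x - y‖ ^ (-((finrank ℝ E : ℝ) + s * p))

/-- The part of the integrand which is invariant, up to powers of `‖y‖`, under inversion in the
unit sphere. -/
noncomputable def weight (p s γ : ℝ) (e y : E) : ℝ :=
  (1 - ‖y‖ ^ γ) ^ (p - 1) * ‖e - y‖ ^ (-((finrank ℝ E : ℝ) + s * p))

lemma weight_pos {p s γ : ℝ} (hγ : 0 < γ) {e y : E} (he : ‖e‖ = 1) (hy : y ∈ puncturedBall E) :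
    0 < weight p s γ e y :=
  mul_pos (Real.rpow_pos_of_pos (one_sub_rpow_pos hγ hy) _)
    (Real.rpow_pos_of_pos (norm_sub_pos he hy) _)

lemma weight_le {p s γ : ℝ} (hp : 1 < p) (hγ : 0 < γ) {e y : E} (he : ‖e‖ = 1)
    (hy : y ∈ puncturedBall E) :
    weight p s γ e y ≤
      max 1 γ ^ (p - 1) * ‖e - y‖ ^ (p - 1 - ((finrank ℝ E : ℝ) + s * p)) := by
  have h0 := norm_sub_pos he hy
  have h1 : (1 - ‖y‖ ^ γ) ^ (p - 1) ≤ (max 1 γ * ‖e - y‖) ^ (p - 1) :=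
    Real.rpow_le_rpow (one_sub_rpow_pos hγ hy).le (one_sub_rpow_norm_le γ he hy) (by linarith)
  rw [Real.mul_rpow (by positivity) h0.le] at h1
  rw [sub_eq_add_neg (p - 1), Real.rpow_add h0, ← mul_assoc]
  exact mul_le_mul_of_nonneg_right h1 (by positivity)

lemma weight_le_rpow {p s γ : ℝ} (hp : 1 < p) (hγ : 0 < γ) {e y : E}
    (hy : y ∈ puncturedBall E) :
    weight p s γ e y ≤ ‖e - y‖ ^ (-((finrank ℝ E : ℝ) + s * p)) := by
  refine mul_le_of_le_one_left (by positivity)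
    (Real.rpow_le_one (one_sub_rpow_pos hγ hy).le ?_ (by linarith))
  have : 0 ≤ ‖y‖ ^ γ := by positivity
  linarith

lemma abs_rpow_mul_self {p a : ℝ} (ha : 0 < a) : |a| ^ (p - 2) * a = a ^ (p - 1) := by
  rw [abs_of_pos ha]
  nth_rewrite 2 [← Real.rpow_one a]
  rw [← Real.rpow_add ha]
  ring_nf

lemma kernel_of_mem_puncturedBall {p s γ : ℝ} (hγ : 0 < γ) {e y : E}
    (he : ‖e‖ = 1) (hy : y ∈ puncturedBall E) :
    kernel p s γ e y = -(‖y‖ ^ (-(γ * (p - 1))) * weight p s γ e y) := by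
  have hy0 : 0 < ‖y‖ := norm_pos_iff.2 hy.1
  have h1 := one_sub_rpow_pos hγ hy
  have key : 1 - ‖y‖ ^ (-γ) = -(‖y‖ ^ (-γ) * (1 - ‖y‖ ^ γ)) := by
    rw [mul_sub, ← Real.rpow_add hy0]
    simp
  rw [kernel, weight, he, Real.one_rpow, key, abs_neg, mul_neg,
    abs_rpow_mul_self (mul_pos (by positivity) h1), Real.mul_rpow (by positivity) h1.le,
    ← Real.rpow_mul hy0.le]
  ring_nf

lemma norm_inversion (y : E) : ‖inversion 0 1 y‖ = ‖y‖⁻¹ := by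
  simpa [dist_zero_right] using dist_inversion_center (0 : E) y 1

lemma norm_sub_inversion {e y : E} (he : ‖e‖ = 1) (hy : y ≠ 0) :
    ‖e - inversion 0 1 y‖ = ‖e - y‖ / ‖y‖ := by
  have he0 : e ≠ 0 := by
    rintro rfl
    simp at he
  have h := dist_inversion_inversion he0 hy 1
  rw [inversion_of_mem_sphere (by simp [he])] at h
  simp only [dist_eq_norm, sub_zero, he, one_pow, one_mul] at h
  rw [h]
  ring

lemma kernel_inversion {p s γ : ℝ} (hγ : 0 < γ) {e y : E}
    (he : ‖e‖ = 1) (hy : y ∈ puncturedBall E) :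
    (‖y‖⁻¹ ^ 2) ^ finrank ℝ E * kernel p s γ e (inversion 0 1 y) =
      ‖y‖ ^ (s * p - finrank ℝ E) * weight p s γ e y := by
  have hy0 : 0 < ‖y‖ := norm_pos_iff.2 hy.1
  have h1 := one_sub_rpow_pos hγ hy
  rw [kernel, weight, he, Real.one_rpow, norm_inversion, norm_sub_inversion he hy.1,
    Real.inv_rpow hy0.le, Real.rpow_neg hy0.le, inv_inv, abs_rpow_mul_self h1,
    Real.div_rpow (norm_nonneg _) hy0.le, Real.rpow_neg hy0.le (_ + _), div_inv_eq_mul]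
  have h2 : (‖y‖⁻¹ ^ 2) ^ finrank ℝ E = ‖y‖ ^ (-(2 * (finrank ℝ E : ℝ))) := by
    rw [Real.rpow_neg hy0.le, ← pow_mul, inv_pow, ← Real.rpow_natCast]
    push_cast
    rfl
  have h3 : s * p - finrank ℝ E = -(2 * (finrank ℝ E : ℝ)) + (finrank ℝ E + s * p) := by ring
  rw [h2, h3, Real.rpow_add hy0 (-(2 * _))]
  ring

variable [FiniteDimensional ℝ E]

lemma abs_det_smul_reflection (K : Submodule ℝ E) (c : ℝ) :
    |(c ^ 2 • (K.reflection : E →L[ℝ] E)).det| = (c ^ 2) ^ finrank ℝ E := by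
  have h : (c ^ 2 • (K.reflection : E →L[ℝ] E)).det =
      LinearMap.det (c ^ 2 • K.reflection.toLinearMap) := rfl
  rw [h, LinearMap.det_smul, Submodule.det_reflection, abs_mul, abs_pow, abs_of_nonneg (sq_nonneg c),
    abs_pow, abs_neg, abs_one, one_pow, mul_one]

variable [MeasurableSpace E] [BorelSpace E]

lemma integrableOn_image_inversion {S : Set E} (hS : MeasurableSet S) (h0 : (0 : E) ∉ S)
    (g : E → ℝ) : IntegrableOn g (inversion 0 1 '' S) ↔
      IntegrableOn (fun y ↦ (‖y‖⁻¹ ^ 2) ^ finrank ℝ E * g (inversion 0 1 y)) S := by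
  have := integrableOn_image_iff_integrableOn_abs_det_fderiv_smul volume hS
    (fun x hx ↦ (hasFDerivAt_inversion (c := 0) (R := 1)
      (ne_of_mem_of_not_mem hx h0)).hasFDerivWithinAt) (inversion_injective 0 one_ne_zero).injOn g
  simp only [abs_det_smul_reflection, dist_zero_right, one_div, smul_eq_mul] at this
  exact this

lemma setIntegral_image_inversion {S : Set E} (hS : MeasurableSet S) (h0 : (0 : E) ∉ S)
    (g : E → ℝ) : ∫ y in inversion 0 1 '' S, g y =
      ∫ y in S, (‖y‖⁻¹ ^ 2) ^ finrank ℝ E * g (inversion 0 1 y) := by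
  have := integral_image_eq_integral_abs_det_fderiv_smul volume hS
    (fun x hx ↦ (hasFDerivAt_inversion (c := 0) (R := 1)
      (ne_of_mem_of_not_mem hx h0)).hasFDerivWithinAt) (inversion_injective 0 one_ne_zero).injOn g
  simp only [abs_det_smul_reflection, dist_zero_right, one_div, smul_eq_mul] at this
  exact this

lemma rpow_le_two_rpow_abs {t w : ℝ} (h1 : 2⁻¹ ≤ t) (h2 : t ≤ 2) : t ^ w ≤ 2 ^ |w| := by
  have h0 : 0 < t := by linarith
  rcases le_total 0 w with hw | hw
  · rw [abs_of_nonneg hw]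
    exact Real.rpow_le_rpow h0.le h2 hw
  · rw [abs_of_nonpos hw, Real.rpow_neg two_pos.le, ← Real.inv_rpow two_pos.le]
    exact Real.rpow_le_rpow_of_nonpos (by norm_num) h1 hw

lemma measurableSet_puncturedBall : MeasurableSet (puncturedBall E) :=
  (measurableSet_singleton (0 : E)).compl.inter
    (measurableSet_lt measurable_norm measurable_const)

omit [FiniteDimensional ℝ E] in
lemma measurable_weight (p s γ : ℝ) (e : E) : Measurable (weight p s γ e) := by
  unfold weight
  fun_prop

lemma integrableOn_ball_rpow_norm [Nontrivial E] {w : ℝ} (hw : -(finrank ℝ E : ℝ) < w) (r : ℝ) :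
    IntegrableOn (fun y : E ↦ ‖y‖ ^ w) (Metric.ball 0 r) := by
  refine integrableOn_ball_of_norm_le_rpow (C := 1) (α := -w) finrank_pos (by linarith)
    (.of_forall fun y ↦ ?_)
    (measurable_norm.pow_const w).aestronglyMeasurable
  rw [neg_neg, one_mul, Real.norm_of_nonneg (by positivity)]

lemma integrableOn_rpow_norm [Nontrivial E] {w : ℝ} (hw : -(finrank ℝ E : ℝ) < w) :
    IntegrableOn (fun y : E ↦ ‖y‖ ^ w) (puncturedBall E) :=
  (integrableOn_ball_rpow_norm hw 1).mono_set fun y hy ↦ by simpa using hy.2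

lemma integrableOn_rpow_norm_sub [Nontrivial E] {w : ℝ} (hw : -(finrank ℝ E : ℝ) < w) {e : E}
    (he : ‖e‖ = 1) : IntegrableOn (fun y : E ↦ ‖e - y‖ ^ w) (puncturedBall E) := by
  have h := ((Measure.measurePreserving_sub_left volume e).integrableOn_comp_preimage
    (MeasurableEquiv.subLeft e).measurableEmbedding).2 (integrableOn_ball_rpow_norm hw 2)
  refine h.mono_set fun y hy ↦ ?_
  have := norm_sub_le e y
  have := hy.2
  simp only [mem_preimage, mem_ball_zero_iff]
  linarith

lemma integrableOn_rpow_mul_weight [Nontrivial E] {p s γ w c : ℝ} (hp : 1 < p) (hs : 0 < s)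
    (hγ : 0 < γ) (hw : -(finrank ℝ E : ℝ) < w) (hc : 0 < c) {e : E} {S : Set E}
    (hS : MeasurableSet S) (hSP : S ⊆ puncturedBall E) (hSc : ∀ y ∈ S, c ≤ ‖e - y‖) :
    IntegrableOn (fun y ↦ ‖y‖ ^ w * weight p s γ e y) S := by
  refine Integrable.mono' (((integrableOn_rpow_norm hw).mono_set hSP).mul_const
    (c ^ (-((finrank ℝ E : ℝ) + s * p)))) ?_ ?_
  · exact ((measurable_norm.pow_const w).mul (measurable_weight p s γ e)).aestronglyMeasurable
  · refine (ae_restrict_iff' hS).2 (.of_forall fun y hy ↦ ?_)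
    have h0 : 0 ≤ weight p s γ e y :=
      mul_nonneg (Real.rpow_nonneg (one_sub_rpow_pos hγ (hSP hy)).le _) (by positivity)
    rw [Real.norm_of_nonneg (by positivity)]
    gcongr
    refine (weight_le_rpow hp hγ (hSP hy)).trans ?_
    exact Real.rpow_le_rpow_of_nonpos hc (hSc y hy)
      (by nlinarith [(finrank ℝ E).cast_nonneg (α := ℝ)])

/-- The integrand obtained by folding `kernel` along the unit sphere by inversion. -/
noncomputable def folded (p s γ : ℝ) (e y : E) : ℝ :=
  (‖y‖ ^ (s * p - finrank ℝ E) - ‖y‖ ^ (-(γ * (p - 1)))) * weight p s γ e y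

omit [FiniteDimensional ℝ E] [MeasurableSpace E] [BorelSpace E] in
lemma folded_pos {p s γ : ℝ} (hγ : 0 < γ) (hγ' : γ * (p - 1) < finrank ℝ E - s * p)
    {e y : E} (he : ‖e‖ = 1) (hy : y ∈ puncturedBall E) : 0 < folded p s γ e y :=
  mul_pos (sub_pos.2 (Real.rpow_lt_rpow_of_exponent_gt (norm_pos_iff.2 hy.1) hy.2 (by linarith)))
    (weight_pos hγ he hy)

omit [FiniteDimensional ℝ E] [MeasurableSpace E] [BorelSpace E] in
lemma folded_le {p s γ : ℝ} (hp : 1 < p) (hγ : 0 < γ) {e y : E} (he : ‖e‖ = 1)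
    (hy : y ∈ puncturedBall E) :
    folded p s γ e y ≤ max 1 (finrank ℝ E - s * p - γ * (p - 1)) * max 1 γ ^ (p - 1) *
      (‖y‖ ^ (s * p - finrank ℝ E) * ‖e - y‖ ^ (p - (finrank ℝ E + s * p))) := by
  have hy0 : 0 < ‖y‖ := norm_pos_iff.2 hy.1
  set β := finrank ℝ E - s * p - γ * (p - 1) with hβ
  have h1 : ‖y‖ ^ (s * p - finrank ℝ E) - ‖y‖ ^ (-(γ * (p - 1))) =
      ‖y‖ ^ (s * p - finrank ℝ E) * (1 - ‖y‖ ^ β) := by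
    rw [mul_sub (‖y‖ ^ _), ← Real.rpow_add hy0, mul_one]
    congr 2
    ring
  have h2 := norm_sub_pos he hy
  have h3 : ‖e - y‖ ^ (p - (finrank ℝ E + s * p)) =
      ‖e - y‖ * ‖e - y‖ ^ (p - 1 - ((finrank ℝ E : ℝ) + s * p)) := by
    nth_rewrite 2 [← Real.rpow_one ‖e - y‖]
    rw [← Real.rpow_add h2]
    congr 1
    ring
  rw [folded, h1, h3, mul_assoc]
  calc _ ≤ ‖y‖ ^ (s * p - finrank ℝ E) * ((max 1 β * ‖e - y‖) *
        (max 1 γ ^ (p - 1) * ‖e - y‖ ^ (p - 1 - ((finrank ℝ E : ℝ) + s * p)))) := by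
        refine mul_le_mul_of_nonneg_left (mul_le_mul (one_sub_rpow_norm_le β he hy)
          (weight_le hp hγ he hy) (weight_pos hγ he hy).le (by positivity)) (by positivity)
    _ = _ := by ring

lemma integrableOn_folded [Nontrivial E] {p s γ : ℝ} (hp : 1 < p) (hs : s ∈ Ioo (0 : ℝ) 1)
    (hγ : 0 < γ) (hγ' : γ * (p - 1) < finrank ℝ E - s * p) {e : E} (he : ‖e‖ = 1) :
    IntegrableOn (folded p s γ e) (puncturedBall E) := by
  set u := s * p - finrank ℝ E with hu
  set w := p - (finrank ℝ E + s * p) with hw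
  have h1 := integrableOn_rpow_norm (E := E) (w := u) (by nlinarith [hs.1])
  have h2 := integrableOn_rpow_norm_sub (w := w) (by nlinarith [hs.2]) he
  refine Integrable.mono' (((h1.const_mul (2 ^ |w|)).add (h2.const_mul (2 ^ |u|))).const_mul
    (max 1 (finrank ℝ E - s * p - γ * (p - 1)) * max 1 γ ^ (p - 1))) ?_ ?_
  · have := measurable_weight p s γ e
    unfold folded
    fun_prop
  · refine (ae_restrict_iff' measurableSet_puncturedBall).2 (.of_forall fun y hy ↦ ?_)
    rw [Real.norm_of_nonneg (folded_pos hγ hγ' he hy).le]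
    refine (folded_le hp hγ he hy).trans (mul_le_mul_of_nonneg_left ?_ (by positivity))
    have h3 := one_sub_norm_le (y := y) he
    have h4 := norm_sub_le e y
    have h5 := hy.2
    have h6 : 0 ≤ ‖y‖ ^ u := by positivity
    have h7 : 0 ≤ ‖e - y‖ ^ w := by positivity
    simp only [Pi.add_apply]
    rcases le_total 2⁻¹ ‖y‖ with h | h
    · have := rpow_le_two_rpow_abs (w := u) h (by linarith)
      have h8 : (0 : ℝ) ≤ 2 ^ |w| := by positivity
      nlinarith
    · have := rpow_le_two_rpow_abs (t := ‖e - y‖) (w := w) (by linarith) (by linarith)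
      have h8 : (0 : ℝ) ≤ 2 ^ |u| := by positivity
      nlinarith

omit [FiniteDimensional ℝ E] [MeasurableSpace E] [BorelSpace E] in
lemma image_inversion_inter_puncturedBall {e : E} (he : ‖e‖ = 1) (δ : ℝ) :
    inversion 0 1 '' (puncturedBall E ∩ {y | δ * ‖y‖ < ‖e - y‖}) =
      {y | 1 < ‖y‖ ∧ δ < ‖e - y‖} := by
  ext z
  constructor
  · rintro ⟨y, ⟨hy, hδ⟩, rfl⟩
    have hy0 : 0 < ‖y‖ := norm_pos_iff.2 hy.1
    rw [mem_ofPred_eq, norm_inversion, norm_sub_inversion he hy.1, lt_div_iff₀ hy0]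
    exact ⟨(one_lt_inv₀ hy0).2 hy.2, hδ⟩
  · rintro ⟨h1, h2⟩
    have hz0 : 0 < ‖z‖ := by linarith
    refine ⟨inversion 0 1 z, ⟨⟨?_, ?_⟩, ?_⟩, inversion_inversion 0 one_ne_zero z⟩
    · rw [← norm_pos_iff, norm_inversion]
      positivity
    · rw [norm_inversion]
      exact inv_lt_one_of_one_lt₀ h1
    · rw [mem_ofPred_eq, norm_inversion, norm_sub_inversion he (norm_pos_iff.1 hz0), div_eq_mul_inv]
      gcongr

lemma setOf_lt_norm_ae_eq [Nontrivial E] (e : E) (δ : ℝ) :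
    {y : E | δ < ‖y - e‖} =ᵐ[volume]
      (puncturedBall E ∩ {y | δ < ‖e - y‖} ∪ {y | 1 < ‖y‖ ∧ δ < ‖e - y‖} : Set E) := by
  have h1 : ∀ᵐ y : E, y ∉ Metric.sphere (0 : E) 1 :=
    measure_eq_zero_iff_ae_notMem.1 (Measure.addHaar_sphere volume 0 1)
  have h2 : ∀ᵐ y : E, y ∉ ({0} : Set E) := measure_eq_zero_iff_ae_notMem.1 (measure_singleton 0)
  rw [eventuallyEq_set]
  filter_upwards [h1, h2] with y hy1 hy2
  have hy1' : ‖y‖ ≠ 1 := by simpa using hy1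
  have hy2' : y ≠ 0 := by simpa using hy2
  simp only [puncturedBall, mem_ofPred_eq, mem_union, mem_inter_iff, norm_sub_rev y e]
  rcases lt_or_gt_of_ne hy1' with h | h
  · simp [h, hy2', h.not_gt]
  · simp [h, hy2', h.not_gt]

lemma setIntegral_kernel [Nontrivial E] {p s γ δ : ℝ} (hp : 1 < p) (hs : 0 < s) (hγ : 0 < γ)
    (hγ' : γ * (p - 1) < finrank ℝ E - s * p) {e : E} (he : ‖e‖ = 1) (hδ : 0 < δ) :
    ∫ y in {y | δ < ‖y - e‖}, kernel p s γ e y =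
      (∫ y in puncturedBall E ∩ {y | δ < ‖e - y‖}, folded p s γ e y) +
      ∫ y in puncturedBall E ∩ {y | δ * ‖y‖ < ‖e - y‖ ∧ ‖e - y‖ ≤ δ},
        ‖y‖ ^ (s * p - finrank ℝ E) * weight p s γ e y := by
  have hsub : Measurable fun y : E ↦ ‖e - y‖ := by fun_prop
  have hP := measurableSet_puncturedBall (E := E)
  set S := puncturedBall E ∩ {y | δ < ‖e - y‖} with hSdef
  set R := puncturedBall E ∩ {y | δ * ‖y‖ < ‖e - y‖ ∧ ‖e - y‖ ≤ δ} with hRdef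
  set T := puncturedBall E ∩ {y | δ * ‖y‖ < ‖e - y‖} with hTdef
  have hS : MeasurableSet S := hP.inter (measurableSet_lt measurable_const hsub)
  have hT : MeasurableSet T := hP.inter (measurableSet_lt (measurable_norm.const_mul δ) hsub)
  have hR : MeasurableSet R := hP.inter ((measurableSet_lt (measurable_norm.const_mul δ) hsub).inter
    (measurableSet_le hsub measurable_const))
  have hTSR : T = S ∪ R := by
    ext y
    simp only [hTdef, hSdef, hRdef, mem_inter_iff, mem_union, mem_ofPred_eq, ← and_or_left]
    refine and_congr_right fun hy ↦ ⟨fun h ↦ ?_, ?_⟩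
    · rcases lt_or_ge δ ‖e - y‖ with h' | h'
      exacts [.inl h', .inr ⟨h, h'⟩]
    · rintro (h | h)
      · have := hy.2
        nlinarith
      · exact h.1
  have hSR : Disjoint S R :=
    Set.disjoint_left.2 fun y hy hy' ↦ hy.2.not_ge hy'.2.2
  have hw : -(finrank ℝ E : ℝ) < s * p - finrank ℝ E := by nlinarith
  have hw' : -(finrank ℝ E : ℝ) < -(γ * (p - 1)) := by nlinarith
  have hTc : ∀ y ∈ T, δ / (1 + δ) ≤ ‖e - y‖ := by
    intro y hy
    have h1 := one_sub_norm_le (y := y) he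
    have h2 : δ * ‖y‖ < ‖e - y‖ := hy.2
    rw [div_le_iff₀ (by linarith)]
    nlinarith
  have hTB : IntegrableOn (fun y ↦ ‖y‖ ^ (s * p - finrank ℝ E) * weight p s γ e y) T :=
    integrableOn_rpow_mul_weight hp hs hγ hw (c := δ / (1 + δ)) (by positivity) hT
      inter_subset_left hTc
  have hSB := hTB.mono_set (hTSR ▸ subset_union_left)
  have hRB := hTB.mono_set (hTSR ▸ subset_union_right)
  have hSA : IntegrableOn (fun y ↦ ‖y‖ ^ (-(γ * (p - 1))) * weight p s γ e y) S :=
    integrableOn_rpow_mul_weight hp hs hγ hw' hδ hS inter_subset_left fun y hy ↦ hy.2.le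
  have hT0 : (0 : E) ∉ T := fun h ↦ h.1.1 rfl
  have hpullback : EqOn
      (fun y ↦ (‖y‖⁻¹ ^ 2) ^ finrank ℝ E * kernel p s γ e (inversion 0 1 y))
      (fun y ↦ ‖y‖ ^ (s * p - finrank ℝ E) * weight p s γ e y) T :=
    fun y hy ↦ kernel_inversion hγ he hy.1
  have hinner : EqOn (kernel p s γ e)
      (fun y ↦ -(‖y‖ ^ (-(γ * (p - 1))) * weight p s γ e y)) S :=
    fun y hy ↦ kernel_of_mem_puncturedBall hγ he hy.1
  have hout : MeasurableSet {y : E | 1 < ‖y‖ ∧ δ < ‖e - y‖} :=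
    (measurableSet_lt measurable_const measurable_norm).inter
      (measurableSet_lt measurable_const hsub)
  have hdisj : Disjoint S {y : E | 1 < ‖y‖ ∧ δ < ‖e - y‖} :=
    Set.disjoint_left.2 fun y hy hy' ↦ hy.1.2.not_gt hy'.1
  have hint : IntegrableOn (kernel p s γ e) {y : E | 1 < ‖y‖ ∧ δ < ‖e - y‖} := by
    rw [← image_inversion_inter_puncturedBall he, integrableOn_image_inversion hT hT0]
    exact hTB.congr_fun hpullback.symm hT
  rw [setIntegral_congr_set (setOf_lt_norm_ae_eq e δ),
    setIntegral_union hdisj hout (hSA.neg.congr_fun hinner.symm hS) hint,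
    ← image_inversion_inter_puncturedBall he, setIntegral_image_inversion hT hT0,
    setIntegral_congr_fun hT hpullback, setIntegral_congr_fun hS hinner, hTSR,
    setIntegral_union hSR hR hSB hRB, ← add_assoc, integral_neg, neg_add_eq_sub,
    ← integral_sub hSB hSA]
  simp only [folded, sub_mul]

lemma tendsto_setIntegral_folded [Nontrivial E] {p s γ : ℝ} (hp : 1 < p)
    (hs : s ∈ Ioo (0 : ℝ) 1) (hγ : 0 < γ) (hγ' : γ * (p - 1) < finrank ℝ E - s * p) {e : E}
    (he : ‖e‖ = 1) :
    Tendsto (fun δ : ℝ ↦ ∫ y in puncturedBall E ∩ {y | δ < ‖e - y‖}, folded p s γ e y)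
      (𝓝[>] 0) (𝓝 (∫ y in puncturedBall E, folded p s γ e y)) := by
  have hint := integrableOn_folded hp hs hγ hγ' he
  have hmeas : ∀ δ : ℝ, MeasurableSet {y : E | δ < ‖e - y‖} := fun δ ↦
    measurableSet_lt measurable_const (by fun_prop)
  simp_rw [← setIntegral_indicator (hmeas _)]
  refine tendsto_integral_filter_of_dominated_convergence (fun y ↦ ‖folded p s γ e y‖)
    (.of_forall fun δ ↦ hint.aestronglyMeasurable.indicator (hmeas δ))
    (.of_forall fun δ ↦ .of_forall fun y ↦ norm_indicator_le_norm_self _ _) hint.norm ?_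
  refine (ae_restrict_iff' measurableSet_puncturedBall).2 (.of_forall fun y hy ↦ ?_)
  refine tendsto_const_nhds.congr' ?_
  filter_upwards [nhdsWithin_le_nhds (eventually_lt_nhds (norm_sub_pos he hy))] with δ hδ
  exact (indicator_of_mem (by exact hδ) _).symm

lemma measureReal_annulus_le [Nontrivial E] (e : E) {δ : ℝ} (hδ : 0 < δ) (hδ1 : δ ≤ 1) :
    volume.real (Metric.closedBall e δ \ Metric.closedBall e (δ * (1 - δ))) ≤
      finrank ℝ E * volume.real (Metric.ball (0 : E) 1) * (δ ^ finrank ℝ E * δ) := by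
  have hδ' : 0 ≤ δ * (1 - δ) := mul_nonneg hδ.le (by linarith)
  rw [measureReal_sdiff (Metric.closedBall_subset_closedBall (by nlinarith))
    measurableSet_closedBall (measure_closedBall_lt_top.ne),
    Measure.addHaar_real_closedBall _ _ hδ.le, Measure.addHaar_real_closedBall _ _ hδ', mul_pow]
  have h1 := one_add_mul_le_pow (a := -δ) (by linarith) (finrank ℝ E)
  have h2 : 0 ≤ volume.real (Metric.ball (0 : E) 1) := measureReal_nonneg
  rw [← sub_eq_add_neg] at h1
  have h3 : 1 - (1 - δ) ^ finrank ℝ E ≤ finrank ℝ E * δ := by linarith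
  calc _ = volume.real (Metric.ball (0 : E) 1) * δ ^ finrank ℝ E *
        (1 - (1 - δ) ^ finrank ℝ E) := by ring
    _ ≤ volume.real (Metric.ball (0 : E) 1) * δ ^ finrank ℝ E * (finrank ℝ E * δ) := by gcongr
    _ = _ := by ring

lemma tendsto_setIntegral_remainder [Nontrivial E] {p s γ : ℝ} (hp : 1 < p)
    (hs : s ∈ Ioo (0 : ℝ) 1) (hγ : 0 < γ) {e : E} (he : ‖e‖ = 1) :
    Tendsto (fun δ : ℝ ↦ ∫ y in puncturedBall E ∩ {y | δ * ‖y‖ < ‖e - y‖ ∧ ‖e - y‖ ≤ δ},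
        ‖y‖ ^ (s * p - finrank ℝ E) * weight p s γ e y) (𝓝[>] 0) (𝓝 0) := by
  set u := s * p - finrank ℝ E with hu
  set w := p - 1 - (finrank ℝ E + s * p) with hw
  set C := 2 ^ |u| * (max 1 γ ^ (p - 1) * 2 ^ |w|) with hC
  set V := finrank ℝ E * volume.real (Metric.ball (0 : E) 1) with hV
  have hlim : Tendsto (fun δ : ℝ ↦ C * V * δ ^ (p - s * p)) (𝓝[>] 0) (𝓝 0) := by
    have h0 : 0 < p - s * p := by nlinarith [hs.2]
    have := ((Real.continuousAt_rpow_const 0 (p - s * p) (.inr h0.le)).tendsto.const_mul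
      (C * V)).mono_left (nhdsWithin_le_nhds (s := Ioi 0))
    simpa [Real.zero_rpow h0.ne'] using this
  refine squeeze_zero_norm' ?_ hlim
  filter_upwards [Ioo_mem_nhdsGT (show (0 : ℝ) < 2⁻¹ by norm_num)] with δ hδ
  obtain ⟨hδ0, hδ1⟩ := hδ
  have hsubset : puncturedBall E ∩ {y | δ * ‖y‖ < ‖e - y‖ ∧ ‖e - y‖ ≤ δ} ⊆
      Metric.closedBall e δ \ Metric.closedBall e (δ * (1 - δ)) := by
    rintro y ⟨hy, h1, h2⟩
    rw [Set.mem_sdiff, mem_closedBall_iff_norm', mem_closedBall_iff_norm']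
    refine ⟨h2, not_le.2 (lt_of_le_of_lt ?_ h1)⟩
    have := one_sub_norm_le (y := y) he
    gcongr
    linarith
  have hbound : ∀ y ∈ puncturedBall E ∩ {y | δ * ‖y‖ < ‖e - y‖ ∧ ‖e - y‖ ≤ δ},
      ‖‖y‖ ^ u * weight p s γ e y‖ ≤ C * δ ^ w := by
    rintro y ⟨hy, h1, h2⟩
    have hy1 := hy.2
    have h3 := one_sub_norm_le (y := y) he
    have h4 := weight_pos (p := p) (s := s) hγ he hy
    have h5 : (‖e - y‖ / δ) ^ w ≤ 2 ^ |w| := by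
      refine rpow_le_two_rpow_abs ?_ ?_
      · rw [le_div_iff₀ hδ0]
        nlinarith
      · rw [div_le_iff₀ hδ0]
        linarith
    rw [Real.div_rpow (norm_nonneg _) hδ0.le, div_le_iff₀ (by positivity)] at h5
    rw [Real.norm_of_nonneg (by positivity), hC, mul_assoc, mul_assoc]
    refine mul_le_mul (rpow_le_two_rpow_abs (by linarith) (by linarith)) ?_ h4.le (by positivity)
    exact (weight_le hp hγ he hy).trans (mul_le_mul_of_nonneg_left h5 (by positivity))
  have hfin : volume (Metric.closedBall e δ \ Metric.closedBall e (δ * (1 - δ))) ≠ ⊤ :=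
    ((measure_mono sdiff_subset).trans_lt measure_closedBall_lt_top).ne
  refine (norm_setIntegral_le_of_norm_le_const ((measure_mono hsubset).trans_lt hfin.lt_top)
    hbound).trans ?_
  calc _ ≤ C * δ ^ w * (V * (δ ^ finrank ℝ E * δ)) :=
        mul_le_mul_of_nonneg_left ((measureReal_mono hsubset hfin).trans
          (measureReal_annulus_le e hδ0 (by linarith))) (by positivity)
    _ = C * V * (δ ^ w * δ ^ (finrank ℝ E : ℝ) * δ ^ (1 : ℝ)) := by
        rw [Real.rpow_natCast, Real.rpow_one]
        ring
    _ = C * V * δ ^ (p - s * p) := by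
        rw [← Real.rpow_add hδ0, ← Real.rpow_add hδ0, hw]
        ring_nf

lemma setIntegral_folded_pos [Nontrivial E] {p s γ : ℝ} (hp : 1 < p)
    (hs : s ∈ Ioo (0 : ℝ) 1) (hγ : 0 < γ) (hγ' : γ * (p - 1) < finrank ℝ E - s * p) {e : E}
    (he : ‖e‖ = 1) : 0 < ∫ y in puncturedBall E, folded p s γ e y := by
  have hopen : IsOpen (puncturedBall E) :=
    isOpen_compl_singleton.inter (isOpen_lt continuous_norm continuous_const)
  have hne : (puncturedBall E).Nonempty := by
    refine ⟨(2⁻¹ : ℝ) • e, ?_, ?_⟩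
    · rw [← norm_pos_iff, norm_smul, he]
      norm_num
    · rw [norm_smul, he]
      norm_num
  rw [setIntegral_pos_iff_support_of_nonneg_ae ?_ (integrableOn_folded hp hs hγ hγ' he)]
  · have hsupp : puncturedBall E ⊆ Function.support (folded p s γ e) :=
      fun y hy ↦ (folded_pos hγ hγ' he hy).ne'
    rw [inter_eq_right.2 hsupp]
    exact hopen.measure_pos _ hne
  · exact (ae_restrict_iff' measurableSet_puncturedBall).2
      (.of_forall fun y hy ↦ (folded_pos hγ hγ' he hy).le)

omit [FiniteDimensional ℝ E] [MeasurableSpace E] [BorelSpace E] in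
lemma exists_linearIsometryEquiv_apply_eq {e x : E} (he : ‖e‖ = 1) (hx : x ≠ 0) :
    ∃ ρ : E ≃ₗᵢ[ℝ] E, ‖x‖ • ρ e = x := by
  have hx0 : ‖x‖ ≠ 0 := norm_ne_zero_iff.2 hx
  refine ⟨(ℝ ∙ (e - ‖x‖⁻¹ • x))ᗮ.reflection, ?_⟩
  rw [Submodule.reflection_sub (by rw [norm_smul, norm_inv, norm_norm, he, inv_mul_cancel₀ hx0]),
    smul_inv_smul₀ hx0]

omit [FiniteDimensional ℝ E] [MeasurableSpace E] [BorelSpace E] in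
lemma kernel_smul {p s γ r : ℝ} (hr : 0 < r) (ρ : E ≃ₗᵢ[ℝ] E) (e z : E) :
    kernel p s γ (r • ρ e) (r • ρ z) =
      r ^ (-(γ * (p - 1)) - ((finrank ℝ E : ℝ) + s * p)) * kernel p s γ e z := by
  have h1 : r ^ (-(γ * (p - 1))) = (r ^ (-γ)) ^ (p - 2) * r ^ (-γ) := by
    rw [← Real.rpow_mul hr.le, ← Real.rpow_add hr]
    congr 1
    ring
  simp only [kernel]
  rw [← smul_sub, ← map_sub, norm_smul, norm_smul, norm_smul, Real.norm_of_nonneg hr.le,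
    ρ.norm_map, ρ.norm_map, ρ.norm_map, Real.mul_rpow hr.le (norm_nonneg _),
    Real.mul_rpow hr.le (norm_nonneg _), Real.mul_rpow hr.le (norm_nonneg _), ← mul_sub, abs_mul,
    abs_of_pos (by positivity : 0 < r ^ (-γ)), Real.mul_rpow (by positivity) (abs_nonneg _),
    sub_eq_add_neg (-(γ * (p - 1))), Real.rpow_add hr, h1]
  ring

lemma setIntegral_kernel_eq {p s γ δ : ℝ} {e x : E} (he : ‖e‖ = 1) (hx : x ≠ 0) :
    ∫ y in {y | δ < ‖y - x‖}, kernel p s γ x y =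
      ‖x‖ ^ (-(p * s + γ * (p - 1))) *
        ∫ z in {z | ‖x‖⁻¹ * δ < ‖z - e‖}, kernel p s γ e z := by
  have hr : 0 < ‖x‖ := norm_pos_iff.2 hx
  have hmeas : ∀ (c : ℝ) (a : E), MeasurableSet {y : E | c < ‖y - a‖} := fun c a ↦
    measurableSet_lt measurable_const (by fun_prop)
  obtain ⟨ρ, hρ⟩ := exists_linearIsometryEquiv_apply_eq he hx
  rw [← integral_indicator (hmeas δ x), ← integral_indicator (hmeas (‖x‖⁻¹ * δ) e)]
  set F := {y | δ < ‖y - x‖}.indicator (kernel p s γ x) with hF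
  have h1 : ∫ y, F y = ‖x‖ ^ (finrank ℝ E : ℝ) * ∫ z, F (‖x‖ • ρ z) := by
    have h2 := ρ.measurePreserving.integral_comp ρ.toHomeomorph.measurableEmbedding
      (fun z ↦ F (‖x‖ • z))
    rw [h2, Measure.integral_comp_smul_of_nonneg volume F _ (hR := hr.le), smul_eq_mul,
      Real.rpow_natCast, mul_inv_cancel_left₀ (by positivity)]
  have h3 : ∀ z, F (‖x‖ • ρ z) = ‖x‖ ^ (-(γ * (p - 1)) - ((finrank ℝ E : ℝ) + s * p)) *
      {z | ‖x‖⁻¹ * δ < ‖z - e‖}.indicator (kernel p s γ e) z := by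
    intro z
    have h4 : ‖x‖ • ρ z ∈ {y | δ < ‖y - x‖} ↔ z ∈ {z | ‖x‖⁻¹ * δ < ‖z - e‖} := by
      simp only [mem_ofPred_eq]
      nth_rewrite 2 [← hρ]
      rw [← smul_sub, ← map_sub, norm_smul, norm_norm, ρ.norm_map, inv_mul_lt_iff₀ hr]
    have h5 : kernel p s γ x (‖x‖ • ρ z) =
        ‖x‖ ^ (-(γ * (p - 1)) - ((finrank ℝ E : ℝ) + s * p)) * kernel p s γ e z := by
      nth_rewrite 1 [← hρ]
      exact kernel_smul hr ρ e z
    by_cases hz : z ∈ {z | ‖x‖⁻¹ * δ < ‖z - e‖}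
    · rw [hF, indicator_of_mem (h4.2 hz), indicator_of_mem hz, h5]
    · rw [hF, indicator_of_notMem (mt h4.1 hz), indicator_of_notMem hz, mul_zero]
  simp_rw [h1, h3]
  rw [integral_const_mul, ← mul_assoc, ← Real.rpow_add hr]
  congr 2
  ring

end FracPLaplacianPower

/-- Fractional `p`-Laplacian of a negative power of the norm: for
`γ ∈ (0, (N - ps)/(p-1))` and `f(z) = |z|^{-γ}`, there is `μ = μ(γ) > 0` such that for
almost every `x ≠ 0`,
`2 lim_{δ→0⁺} ∫_{|y-x|>δ} |f(x)-f(y)|^{p-2}(f(x)-f(y)) |x-y|^{-(N+sp)} dy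
  = μ(γ) |x|^{-(ps + γ(p-1))}`. -/
theorem fractional_pLaplacian_of_power
    (N : ℕ) (hN : 1 ≤ N) (p s γ : ℝ) (hp : 1 < p) (hs : s ∈ Set.Ioo (0 : ℝ) 1)
    (hNs : s * p < N) (hγ : γ ∈ Set.Ioo (0 : ℝ) (((N : ℝ) - p * s) / (p - 1))) :
    ∃ μ : ℝ, 0 < μ ∧
      ∀ᵐ x : EuclideanSpace ℝ (Fin N), x ≠ 0 →
        Filter.Tendsto
          (fun δ : ℝ =>
            2 * ∫ y in {y : EuclideanSpace ℝ (Fin N) | δ < ‖y - x‖},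
              |‖x‖ ^ (-γ) - ‖y‖ ^ (-γ)| ^ (p - 2) * (‖x‖ ^ (-γ) - ‖y‖ ^ (-γ)) *
                ‖x - y‖ ^ (-((N : ℝ) + s * p)))
          (nhdsWithin 0 (Set.Ioi 0))
          (nhds (μ * ‖x‖ ^ (-(p * s + γ * (p - 1))))) := by
  obtain ⟨hγ0, hγ1⟩ := hγ
  rw [lt_div_iff₀ (by linarith)] at hγ1
  have hfin : Module.finrank ℝ (EuclideanSpace ℝ (Fin N)) = N := finrank_euclideanSpace_fin
  have hγ' : γ * (p - 1) < Module.finrank ℝ (EuclideanSpace ℝ (Fin N)) - s * p := by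
    rw [hfin]
    linarith
  have : Nontrivial (EuclideanSpace ℝ (Fin N)) :=
    Module.nontrivial_of_finrank_pos (R := ℝ) (by omega)
  obtain ⟨e, he⟩ := exists_norm_eq (EuclideanSpace ℝ (Fin N)) zero_le_one
  refine ⟨2 * ∫ y in FracPLaplacianPower.puncturedBall (EuclideanSpace ℝ (Fin N)),
    FracPLaplacianPower.folded p s γ e y,
    mul_pos two_pos (FracPLaplacianPower.setIntegral_folded_pos hp hs hγ0 hγ' he),
    .of_forall fun x hx ↦ ?_⟩
  have hlim := (FracPLaplacianPower.tendsto_setIntegral_folded hp hs hγ0 hγ' he).add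
    (FracPLaplacianPower.tendsto_setIntegral_remainder hp hs hγ0 he)
  rw [add_zero] at hlim
  have hx0 : 0 < ‖x‖⁻¹ := inv_pos.2 (norm_pos_iff.2 hx)
  have hscale : Filter.Tendsto (fun δ : ℝ => ‖x‖⁻¹ * δ) (nhdsWithin 0 (Set.Ioi 0))
      (nhdsWithin 0 (Set.Ioi 0)) := by
    refine tendsto_nhdsWithin_iff.2 ⟨?_, ?_⟩
    · simpa using ((continuous_const_mul ‖x‖⁻¹).tendsto 0).mono_left
        (nhdsWithin_le_nhds (s := Set.Ioi 0))
    · filter_upwards [self_mem_nhdsWithin] with δ hδ using mul_pos hx0 hδ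
  have hmain := ((hlim.comp hscale).const_mul (‖x‖ ^ (-(p * s + γ * (p - 1))))).const_mul 2
  rw [mul_left_comm, mul_comm (‖x‖ ^ _)] at hmain
  refine hmain.congr' ?_
  filter_upwards [self_mem_nhdsWithin] with δ hδ
  have h := FracPLaplacianPower.setIntegral_kernel_eq (p := p) (s := s) (γ := γ) (δ := δ) he hx
  rw [FracPLaplacianPower.setIntegral_kernel hp hs.1 hγ0 hγ' he (mul_pos hx0 hδ)] at h
  simp only [FracPLaplacianPower.kernel, hfin] at h
  rw [h, hfin]
  simp only [Function.comp_apply]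
end

section
/- (Fractional Hardy inequality, Euclidean case of the paper's Hardy theorem.) Let N ≥ 1, p > 1, s ∈ (0,1) with N > sp. Then there exists a constant C = C(N,p,s) > 0 such that for all u ∈ C_c^∞(ℝ^N), C ∫_{ℝ^N} |u(x)|^p / |x|^{ps} dx ≤ [u]_{s,p}^p. -/
open MeasureTheory

/-- The kernel `‖x‖ ^ (-q)` restricted to the pairs with `t * ‖x‖ < ‖y‖ < 2 * t * ‖x‖`. -/
noncomputable def annulusKernel {E : Type*} [NormedAddCommGroup E] (t q : ℝ) (x y : E) : ENNReal :=
  {z : E × E | t * ‖z.1‖ < ‖z.2‖ ∧ ‖z.2‖ < 2 * t * ‖z.1‖}.indicator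
    (fun z => ENNReal.ofReal (‖z.1‖ ^ (-q))) (x, y)

section annulusKernel

variable {E : Type*} [NormedAddCommGroup E] [MeasurableSpace E] [BorelSpace E]

lemma measurable_annulusKernel [SecondCountableTopology E] (t q : ℝ) :
    Measurable fun z : E × E => annulusKernel t q z.1 z.2 := by
  refine Measurable.indicator (by fun_prop) ?_
  rw [Set.ofPred_and]
  exact MeasurableSet.inter (measurableSet_lt (by fun_prop) (by fun_prop))
    (measurableSet_lt (by fun_prop) (by fun_prop))

lemma annulusKernel_le {E : Type*} [NormedAddCommGroup E] {t q : ℝ} (ht : 1 ≤ t) (hq : 0 ≤ q)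
    (x y : E) :
    annulusKernel t q x y ≤ ENNReal.ofReal ((1 + 2 * t) ^ q * ‖x - y‖ ^ (-q)) := by
  refine Set.indicator_apply_le' (fun h => ?_) fun _ => zero_le
  obtain ⟨h₁, h₂⟩ : t * ‖x‖ < ‖y‖ ∧ ‖y‖ < 2 * t * ‖x‖ := h
  have hx : 0 < ‖x‖ := by nlinarith [norm_nonneg x]
  have hxy : 0 < ‖x - y‖ := by
    refine norm_pos_iff.2 (sub_ne_zero.2 ?_)
    rintro rfl
    nlinarith
  have hle : ‖x - y‖ ≤ (1 + 2 * t) * ‖x‖ := by linarith [norm_sub_le x y]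
  apply ENNReal.ofReal_le_ofReal
  have h := Real.rpow_le_rpow hxy.le hle hq
  rw [Real.mul_rpow (by positivity) hx.le] at h
  dsimp only
  rw [Real.rpow_neg hx.le, Real.rpow_neg hxy.le, ← div_eq_mul_inv, le_div_iff₀ (by positivity),
    inv_mul_le_iff₀ (by positivity)]
  linarith

variable [NormedSpace ℝ E] [FiniteDimensional ℝ E] [Nontrivial E]
  (μ : Measure E) [μ.IsAddHaarMeasure]

lemma le_measure_annulus {r : ℝ} (hr : 0 ≤ r) :
    ENNReal.ofReal (r ^ Module.finrank ℝ E) * μ (Metric.ball 0 1) ≤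
      μ {y | r < ‖y‖ ∧ ‖y‖ < 2 * r} := by
  have hset : {y : E | r < ‖y‖ ∧ ‖y‖ < 2 * r} = Metric.ball 0 (2 * r) \ Metric.closedBall 0 r := by
    ext y
    simp [and_comm]
  have hn : (2 : ℝ) ≤ 2 ^ Module.finrank ℝ E :=
    le_self_pow₀ one_le_two Module.finrank_pos.ne'
  rw [hset]
  refine le_trans ?_ (le_measure_sdiff (μ := μ))
  rw [μ.addHaar_closedBall 0 hr, μ.addHaar_ball 0 (by positivity : 0 ≤ 2 * r)]
  refine ENNReal.le_sub_of_add_le_right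
    (ENNReal.mul_ne_top ENNReal.ofReal_ne_top measure_ball_lt_top.ne) ?_
  rw [← add_mul, ← ENNReal.ofReal_add (by positivity) (by positivity), mul_pow]
  gcongr
  nlinarith [pow_nonneg hr (Module.finrank ℝ E)]

lemma le_lintegral_annulusKernel_right {t : ℝ} (ht : 0 ≤ t) (a : ℝ) {x : E} (hx : x ≠ 0) :
    ENNReal.ofReal (t ^ Module.finrank ℝ E) * μ (Metric.ball 0 1) * ENNReal.ofReal (‖x‖ ^ (-a)) ≤
      ∫⁻ y, annulusKernel t (Module.finrank ℝ E + a) x y ∂μ := by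
  have hx' : 0 < ‖x‖ := norm_pos_iff.2 hx
  have hint : ∫⁻ y, annulusKernel t (Module.finrank ℝ E + a) x y ∂μ =
      ENNReal.ofReal (‖x‖ ^ (-(Module.finrank ℝ E + a))) *
        μ {y | t * ‖x‖ < ‖y‖ ∧ ‖y‖ < 2 * (t * ‖x‖)} := by
    rw [← lintegral_indicator_const]
    · refine lintegral_congr fun y => ?_
      simp [annulusKernel, Set.indicator_apply, mul_assoc]
    · rw [Set.ofPred_and]
      exact MeasurableSet.inter (measurableSet_lt (by fun_prop) (by fun_prop))
        (measurableSet_lt (by fun_prop) (by fun_prop))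
  rw [hint]
  grw [← le_measure_annulus μ (by positivity : 0 ≤ t * ‖x‖)]
  rw [← mul_assoc, ← ENNReal.ofReal_mul (by positivity), mul_right_comm,
    ← ENNReal.ofReal_mul (by positivity)]
  gcongr ENNReal.ofReal ?_ * _
  apply le_of_eq
  rw [mul_pow, ← Real.rpow_natCast ‖x‖, neg_add, Real.rpow_add hx',
    Real.rpow_neg hx'.le (Module.finrank ℝ E), Real.rpow_natCast]
  field_simp

lemma lintegral_annulusKernel_left_le {t a : ℝ} (ht : 0 < t) (ha : 0 ≤ a) {y : E} (hy : y ≠ 0) :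
    ∫⁻ x, annulusKernel t (Module.finrank ℝ E + a) x y ∂μ ≤
      ENNReal.ofReal (2 ^ (Module.finrank ℝ E + a) * t ^ a) * μ (Metric.ball 0 1) *
        ENNReal.ofReal (‖y‖ ^ (-a)) := by
  have hy' : 0 < ‖y‖ := norm_pos_iff.2 hy
  have hle : ∀ x, annulusKernel t (Module.finrank ℝ E + a) x y ≤
      (Metric.ball (0 : E) (‖y‖ / t)).indicator
        (fun _ => ENNReal.ofReal ((2 * t / ‖y‖) ^ (Module.finrank ℝ E + a))) x := by
    intro x
    refine Set.indicator_apply_le' (fun h => ?_) fun _ => zero_le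
    obtain ⟨h₁, h₂⟩ : t * ‖x‖ < ‖y‖ ∧ ‖y‖ < 2 * t * ‖x‖ := h
    have hx : 0 < ‖x‖ := by
      by_contra hx
      nlinarith
    rw [Set.indicator_of_mem]
    · apply ENNReal.ofReal_le_ofReal
      dsimp only
      rw [Real.rpow_neg hx.le, ← Real.inv_rpow hx.le]
      refine Real.rpow_le_rpow (by positivity) ?_ (by positivity)
      rw [inv_le_iff_one_le_mul₀ hx, div_mul_eq_mul_div, one_le_div hy']
      exact h₂.le
    · rw [mem_ball_zero_iff, lt_div_iff₀ ht]
      linarith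
  refine (lintegral_mono hle).trans ?_
  rw [lintegral_indicator_const measurableSet_ball, μ.addHaar_ball 0 (by positivity), ← mul_assoc,
    ← ENNReal.ofReal_mul (by positivity), mul_right_comm, ← ENNReal.ofReal_mul (by positivity)]
  gcongr ENNReal.ofReal ?_ * _
  apply le_of_eq
  rw [Real.div_rpow (by positivity) hy'.le, Real.mul_rpow (by positivity) ht.le, div_pow,
    Real.rpow_add hy', Real.rpow_add ht, Real.rpow_neg hy'.le, Real.rpow_natCast,
    Real.rpow_natCast]
  field_simp

end annulusKernel

lemma abs_rpow_le_two_rpow_mul {p : ℝ} (hp : 1 ≤ p) (a b : ℝ) :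
    |a| ^ p ≤ 2 ^ p * (|a - b| ^ p + |b| ^ p) := by
  have h₁ : |a| ≤ 2 * max |a - b| |b| := by
    have := abs_add_le (a - b) b
    rw [sub_add_cancel] at this
    linarith [le_max_left |a - b| |b|, le_max_right |a - b| |b|]
  have h₂ := Real.rpow_le_rpow (abs_nonneg a) h₁ (by linarith : 0 ≤ p)
  rw [Real.mul_rpow (by norm_num) (by positivity)] at h₂
  refine h₂.trans ?_
  gcongr
  rcases max_cases |a - b| |b| with ⟨h, -⟩ | ⟨h, -⟩ <;> rw [h] <;>
    linarith [Real.rpow_nonneg (abs_nonneg (a - b)) p, Real.rpow_nonneg (abs_nonneg b) p]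

section

variable {E : Type*} [NormedAddCommGroup E] [MeasurableSpace E] [BorelSpace E]
  [NormedSpace ℝ E] [FiniteDimensional ℝ E] [Nontrivial E]
  (μ : Measure E) [μ.IsAddHaarMeasure]

lemma lintegral_abs_rpow_mul_norm_rpow_lt_top {u : E → ℝ} (hu : Continuous u)
    (hc : HasCompactSupport u) {p a : ℝ} (hp : 0 < p) (ha : a < Module.finrank ℝ E) :
    ∫⁻ x, ENNReal.ofReal (|u x| ^ p) * ENNReal.ofReal (‖x‖ ^ (-a)) ∂μ < ⊤ := by
  obtain ⟨M, hM⟩ := hc.exists_bound_of_continuous hu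
  obtain ⟨R, -, hR⟩ := hc.isCompact.isBounded.exists_pos_norm_lt
  have hint : IntegrableOn (fun x => |u x| ^ p * ‖x‖ ^ (-a)) (Metric.ball 0 R) μ := by
    refine integrableOn_ball_of_norm_le_rpow (C := M ^ p) Module.finrank_pos ha
      (Filter.Eventually.of_forall fun x => ?_) (Measurable.aestronglyMeasurable ?_)
    · rw [Real.norm_of_nonneg (by positivity)]
      gcongr
      exact hM x
    · have := hu.measurable
      fun_prop
  have hsupp : Function.support (fun x => |u x| ^ p * ‖x‖ ^ (-a)) ⊆ Metric.ball 0 R := by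
    intro x hx
    refine mem_ball_zero_iff.2 (hR x (subset_tsupport u fun h => hx ?_))
    simp [h, Real.zero_rpow hp.ne']
  rw [integrableOn_iff_integrable_of_support_subset hsupp] at hint
  refine lt_of_le_of_lt (le_of_eq ?_) hint.lintegral_lt_top
  exact lintegral_congr fun x => (ENNReal.ofReal_mul (by positivity)).symm

lemma abs_rpow_mul_annulusKernel_le {E : Type*} [NormedAddCommGroup E] {p q t : ℝ} (hp : 1 ≤ p)
    (hq : 0 ≤ q) (ht : 1 ≤ t) (u : E → ℝ) (x y : E) :
    ENNReal.ofReal (|u x| ^ p) * annulusKernel t q x y ≤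
      ENNReal.ofReal (2 ^ p * (1 + 2 * t) ^ q) * ENNReal.ofReal
          (|u x - u y| ^ p * ‖x - y‖ ^ (-q)) +
        ENNReal.ofReal (2 ^ p) * (ENNReal.ofReal (|u y| ^ p) * annulusKernel t q x y) := by
  grw [abs_rpow_le_two_rpow_mul hp (u x) (u y)]
  rw [ENNReal.ofReal_mul (by positivity), ENNReal.ofReal_add (by positivity) (by positivity),
    mul_add, add_mul, ← mul_assoc (ENNReal.ofReal (2 ^ p)) (ENNReal.ofReal (|u y| ^ p))]
  gcongr ?_ + _
  grw [annulusKernel_le ht hq x y]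
  rw [← ENNReal.ofReal_mul (by positivity), ← ENNReal.ofReal_mul (by positivity),
    ← ENNReal.ofReal_mul (by positivity)]
  apply le_of_eq
  congr 1
  ring

lemma lintegral_mul_lintegral_annulusKernel_le {E : Type*} [NormedAddCommGroup E]
    [MeasurableSpace E] [BorelSpace E] [SecondCountableTopology E] (μ : Measure E) [SFinite μ]
    {u : E → ℝ} (hu : Measurable u) {p q t : ℝ} (hp : 1 ≤ p) (hq : 0 ≤ q) (ht : 1 ≤ t) :
    ∫⁻ x, ENNReal.ofReal (|u x| ^ p) * ∫⁻ y, annulusKernel t q x y ∂μ ∂μ ≤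
      ENNReal.ofReal (2 ^ p * (1 + 2 * t) ^ q) *
          (∫⁻ x, ∫⁻ y, ENNReal.ofReal (|u x - u y| ^ p * ‖x - y‖ ^ (-q)) ∂μ ∂μ) +
        ENNReal.ofReal (2 ^ p) *
          ∫⁻ y, ENNReal.ofReal (|u y| ^ p) * ∫⁻ x, annulusKernel t q x y ∂μ ∂μ := by
  have hK := measurable_annulusKernel (E := E) t q
  have hF : Measurable fun x => ENNReal.ofReal (|u x| ^ p) := by fun_prop
  have hG : Measurable fun z : E × E =>
      ENNReal.ofReal (|u z.1 - u z.2| ^ p * ‖z.1 - z.2‖ ^ (-q)) := by fun_prop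
  have hFK : Measurable fun z : E × E =>
      ENNReal.ofReal (|u z.2| ^ p) * annulusKernel t q z.1 z.2 :=
    (hF.comp measurable_snd).mul hK
  have hGi : Measurable fun x =>
      ∫⁻ y, ENNReal.ofReal (|u x - u y| ^ p * ‖x - y‖ ^ (-q)) ∂μ := hG.lintegral_prod_right'
  have hFKi : Measurable fun x =>
      ∫⁻ y, ENNReal.ofReal (|u y| ^ p) * annulusKernel t q x y ∂μ := hFK.lintegral_prod_right'
  have hGx (x : E) : Measurable fun y => ENNReal.ofReal (|u x - u y| ^ p * ‖x - y‖ ^ (-q)) := by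
    fun_prop
  have hKx (x : E) : Measurable fun y => annulusKernel t q x y := hK.comp measurable_prodMk_left
  have hFKx (x : E) : Measurable fun y => ENNReal.ofReal (|u y| ^ p) * annulusKernel t q x y :=
    hF.mul (hKx x)
  have hKy (y : E) : Measurable fun x => annulusKernel t q x y := hK.comp measurable_prodMk_right
  calc
    ∫⁻ x, ENNReal.ofReal (|u x| ^ p) * ∫⁻ y, annulusKernel t q x y ∂μ ∂μ
      = ∫⁻ x, ∫⁻ y, ENNReal.ofReal (|u x| ^ p) * annulusKernel t q x y ∂μ ∂μ := by
        simp_rw [lintegral_const_mul _ (hKx _)]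
    _ ≤ ∫⁻ x, ∫⁻ y, (ENNReal.ofReal (2 ^ p * (1 + 2 * t) ^ q) * ENNReal.ofReal
            (|u x - u y| ^ p * ‖x - y‖ ^ (-q)) +
          ENNReal.ofReal (2 ^ p) *
            (ENNReal.ofReal (|u y| ^ p) * annulusKernel t q x y)) ∂μ ∂μ := by
        exact lintegral_mono fun x => lintegral_mono fun y =>
          abs_rpow_mul_annulusKernel_le hp hq ht u x y
    _ = ENNReal.ofReal (2 ^ p * (1 + 2 * t) ^ q) *
          (∫⁻ x, ∫⁻ y, ENNReal.ofReal (|u x - u y| ^ p * ‖x - y‖ ^ (-q)) ∂μ ∂μ) +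
        ENNReal.ofReal (2 ^ p) *
          ∫⁻ x, ∫⁻ y, ENNReal.ofReal (|u y| ^ p) * annulusKernel t q x y ∂μ ∂μ := by
        simp_rw [lintegral_add_left ((hGx _).const_mul _), lintegral_const_mul _ (hGx _),
          lintegral_const_mul _ (hFKx _)]
        rw [lintegral_add_left (hGi.const_mul _), lintegral_const_mul _ hGi,
          lintegral_const_mul _ hFKi]
    _ = ENNReal.ofReal (2 ^ p * (1 + 2 * t) ^ q) *
          (∫⁻ x, ∫⁻ y, ENNReal.ofReal (|u x - u y| ^ p * ‖x - y‖ ^ (-q)) ∂μ ∂μ) +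
        ENNReal.ofReal (2 ^ p) *
          ∫⁻ y, ENNReal.ofReal (|u y| ^ p) * ∫⁻ x, annulusKernel t q x y ∂μ ∂μ := by
        rw [lintegral_lintegral_swap
          (f := fun x y => ENNReal.ofReal (|u y| ^ p) * annulusKernel t q x y) hFK.aemeasurable]
        simp_rw [lintegral_const_mul _ (hKy _)]

lemma lintegral_abs_rpow_mul_norm_rpow_le_add {u : E → ℝ} (hu : Measurable u)
    {p a t : ℝ} (hp : 1 ≤ p) (ha : 0 ≤ a) (ht : 1 ≤ t) :
    ENNReal.ofReal (t ^ Module.finrank ℝ E) * (μ (Metric.ball 0 1) *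
        ∫⁻ x, ENNReal.ofReal (|u x| ^ p) * ENNReal.ofReal (‖x‖ ^ (-a)) ∂μ) ≤
      ENNReal.ofReal (2 ^ p * (1 + 2 * t) ^ (Module.finrank ℝ E + a)) *
          (∫⁻ x, ∫⁻ y, ENNReal.ofReal
            (|u x - u y| ^ p * ‖x - y‖ ^ (-(Module.finrank ℝ E + a))) ∂μ ∂μ) +
        ENNReal.ofReal (2 ^ p * (2 ^ (Module.finrank ℝ E + a) * t ^ a)) * (μ (Metric.ball 0 1) *
          ∫⁻ x, ENNReal.ofReal (|u x| ^ p) * ENNReal.ofReal (‖x‖ ^ (-a)) ∂μ) := by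
  have ht0 : 0 < t := by linarith
  have hne : ∀ᵐ x ∂μ, x ≠ 0 := by
    simp [ae_iff]
  calc
    ENNReal.ofReal (t ^ Module.finrank ℝ E) * (μ (Metric.ball 0 1) *
      ∫⁻ x, ENNReal.ofReal (|u x| ^ p) * ENNReal.ofReal (‖x‖ ^ (-a)) ∂μ)
      = ∫⁻ x, ENNReal.ofReal (|u x| ^ p) *
          (ENNReal.ofReal (t ^ Module.finrank ℝ E) * μ (Metric.ball 0 1) *
            ENNReal.ofReal (‖x‖ ^ (-a))) ∂μ := by
        rw [← mul_assoc, ← lintegral_const_mul _ (by fun_prop)]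
        refine lintegral_congr fun x => by ring
    _ ≤ ∫⁻ x, ENNReal.ofReal (|u x| ^ p) *
          ∫⁻ y, annulusKernel t (Module.finrank ℝ E + a) x y ∂μ ∂μ := by
        refine lintegral_mono_ae ?_
        filter_upwards [hne] with x hx
        gcongr
        exact le_lintegral_annulusKernel_right μ ht0.le a hx
    _ ≤ _ := by
        grw [lintegral_mul_lintegral_annulusKernel_le μ hu hp (by positivity) ht]
        gcongr _ + ?_
        rw [ENNReal.ofReal_mul (by positivity), mul_assoc]
        gcongr
        rw [← mul_assoc, ← lintegral_const_mul _ (by fun_prop)]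
        refine lintegral_mono_ae ?_
        filter_upwards [hne] with y hy
        grw [lintegral_annulusKernel_left_le μ ht0 ha hy]
        apply le_of_eq
        ring

theorem exists_mul_lintegral_abs_rpow_mul_norm_rpow_le {p a : ℝ} (hp : 1 ≤ p) (ha : 0 ≤ a)
    (han : a < Module.finrank ℝ E) :
    ∃ C : ℝ, 0 < C ∧ ∀ u : E → ℝ, Continuous u → HasCompactSupport u →
      ENNReal.ofReal C *
          ∫⁻ x, ENNReal.ofReal (|u x| ^ p) * ENNReal.ofReal (‖x‖ ^ (-a)) ∂μ ≤
        ∫⁻ x, ∫⁻ y, ENNReal.ofReal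
          (|u x - u y| ^ p * ‖x - y‖ ^ (-(Module.finrank ℝ E + a))) ∂μ ∂μ := by
  set n := Module.finrank ℝ E
  obtain ⟨t, ht, hlarge⟩ : ∃ t : ℝ, 1 ≤ t ∧ 2 ^ p * (2 ^ (n + a) * t ^ a) ≤ t ^ n / 2 := by
    have hna : 0 < n - a := by linarith
    refine ⟨2 ^ ((p + (n + a) + 1) / (n - a)), Real.one_le_rpow one_le_two (by positivity), ?_⟩
    rw [← Real.rpow_natCast, ← Real.rpow_mul (by norm_num), ← Real.rpow_mul (by norm_num),
      le_div_iff₀ (by norm_num), ← Real.rpow_add (by norm_num), ← Real.rpow_add (by norm_num),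
      ← Real.rpow_add_one (by norm_num)]
    refine (congrArg _ ?_).le
    field_simp
    ring
  have ht0 : 0 < t := by linarith
  have hm_top : μ (Metric.ball (0 : E) 1) ≠ ⊤ := measure_ball_lt_top.ne
  have hm : 0 < μ.real (Metric.ball (0 : E) 1) :=
    ENNReal.toReal_pos (Metric.measure_ball_pos μ 0 one_pos).ne' hm_top
  refine ⟨(t ^ n / 2 * μ.real (Metric.ball (0 : E) 1)) / (2 ^ p * (1 + 2 * t) ^ (n + a)),
    by positivity, fun u hu hc => ?_⟩
  have hfin := lintegral_abs_rpow_mul_norm_rpow_lt_top μ hu hc (by linarith : 0 < p) han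
  have key := lintegral_abs_rpow_mul_norm_rpow_le_add μ hu.measurable hp ha ht
  set A := ∫⁻ x, ENNReal.ofReal (|u x| ^ p) * ENNReal.ofReal (‖x‖ ^ (-a)) ∂μ
  have hhalf : ENNReal.ofReal (t ^ Module.finrank ℝ E) =
      ENNReal.ofReal (t ^ Module.finrank ℝ E / 2) +
        ENNReal.ofReal (t ^ Module.finrank ℝ E / 2) := by
    rw [← ENNReal.ofReal_add (by positivity) (by positivity), add_halves]
  grw [hlarge] at key
  rw [hhalf, add_mul] at key
  replace key := ENNReal.le_of_add_le_add_right
    (ENNReal.mul_ne_top ENNReal.ofReal_ne_top (ENNReal.mul_ne_top hm_top hfin.ne)) key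
  rw [ENNReal.ofReal_div_of_pos (by positivity), ENNReal.div_eq_inv_mul, mul_assoc,
    ENNReal.inv_mul_le_iff (ENNReal.ofReal_pos.2 (by positivity)).ne' ENNReal.ofReal_ne_top,
    ENNReal.ofReal_mul (by positivity), ofReal_measureReal hm_top, mul_assoc]
  exact key

end

/-- Fractional Hardy inequality: for `N ≥ 1`, `p > 1`, `s ∈ (0,1)` with `N > sp` there is
`C = C(N,p,s) > 0` such that for every `u ∈ C_c^∞(ℝ^N)`,
`C ∫ |u(x)|^p / |x|^{ps} dx ≤ [u]_{s,p}^p`. -/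
theorem fractional_hardy_inequality
    (N : ℕ) (hN : 1 ≤ N) (p s : ℝ) (hp : 1 < p) (hs : s ∈ Set.Ioo (0 : ℝ) 1)
    (hNs : s * p < N) :
    ∃ C : ℝ, 0 < C ∧
      ∀ u : EuclideanSpace ℝ (Fin N) → ℝ, ContDiff ℝ (⊤ : ℕ∞) u → HasCompactSupport u →
        ENNReal.ofReal C * ∫⁻ x, ENNReal.ofReal (|u x| ^ p / ‖x‖ ^ (p * s)) ≤
          ∫⁻ x, ∫⁻ y,
            ENNReal.ofReal (|u x - u y| ^ p / ‖x - y‖ ^ ((N : ℝ) + s * p)) := by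
  have : Nonempty (Fin N) := ⟨⟨0, hN⟩⟩
  have hsp : 0 ≤ s * p := mul_nonneg hs.1.le (by linarith)
  obtain ⟨C, hC, h⟩ := exists_mul_lintegral_abs_rpow_mul_norm_rpow_le
    (volume : Measure (EuclideanSpace ℝ (Fin N))) hp.le hsp (by simpa using hNs)
  refine ⟨C, hC, fun u hu hc => ?_⟩
  convert h u hu.continuous hc using 3
  · funext x
    rw [← ENNReal.ofReal_mul (by positivity), Real.rpow_neg (norm_nonneg x), div_eq_mul_inv,
      mul_comm p s]
  · rename_i x
    refine lintegral_congr fun y => ?_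
    rw [Real.rpow_neg (norm_nonneg _), div_eq_mul_inv, finrank_euclideanSpace_fin]
end

section
/- (Lower bound for the first Dirichlet eigenvalue of the fractional p-Laplacian, Euclidean case.) Let N ≥ 1, p > 1, s ∈ (0,1) with N > sp, and let Ω ⊂ ℝ^N be a bounded measurable set with 0 < |Ω| < ∞; set r_Ω := sup{ |x| : x ∈ Ω } and assume 0 < r_Ω < ∞. Then there exists a constant C = C(N,p,s) > 0 such that for every θ with N/(sp) < θ < ∞ and every u ∈ C_c^∞(Ω) with u not identically zero, [u]_{s,p}^p / ‖u‖_{L^p(Ω)}^p ≥ C / ( |Ω|^{1/θ} r_Ω^{sp − N/θ} ). In particular, the first eigenvalue λ₁ = inf{ [u]_{s,p}^p / ‖u‖_{L^p}^p : u ∈ C_c^∞(Ω), u ≢ 0 } satisfies λ₁ ≥ sup_{N/(sp) < θ < ∞} C / ( |Ω|^{1/θ} r_Ω^{sp − N/θ} ). -/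
open MeasureTheory

/-- A function vanishing off a set `Ω` of finite measure `k R ^ N` has its Gagliardo energy
controlled from below by the interaction of `Ω` with `ball x R \ Ω`, provided every ball of
radius `R` has measure `2 k R ^ N`. -/
lemma ofReal_mul_lintegral_le_gagliardo {N : ℕ} {p σ k R : ℝ} (hσ : 0 < σ)
    (hk : 0 < k) (hR : 0 < R) {Ω : Set (EuclideanSpace ℝ (Fin N))} (hΩ : MeasurableSet Ω)
    (hvol : volume Ω = ENNReal.ofReal (k * R ^ N))
    (hball : ∀ x : EuclideanSpace ℝ (Fin N),
      volume (Metric.ball x R) = ENNReal.ofReal (2 * (k * R ^ N)))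
    {u : EuclideanSpace ℝ (Fin N) → ℝ} (hu : ∀ x ∉ Ω, u x = 0) :
    ENNReal.ofReal (k / R ^ σ) * ∫⁻ x in Ω, ENNReal.ofReal (|u x| ^ p) ≤
      ∫⁻ x, ∫⁻ y, ENNReal.ofReal (|u x - u y| ^ p / ‖x - y‖ ^ ((N : ℝ) + σ)) := by
  refine (lintegral_const_mul_le _ _).trans ?_
  refine le_trans (setLIntegral_mono' hΩ fun x hx => ?_) (setLIntegral_le_lintegral Ω _)
  have hmeas : ENNReal.ofReal (k * R ^ N) ≤ volume (Metric.ball x R \ Ω) := by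
    refine le_trans ?_ le_measure_sdiff
    rw [hvol, hball, ← ENNReal.ofReal_sub _ (by positivity)]
    exact ENNReal.ofReal_le_ofReal (by linarith)
  calc ENNReal.ofReal (k / R ^ σ) * ENNReal.ofReal (|u x| ^ p)
      = ENNReal.ofReal (|u x| ^ p / R ^ ((N : ℝ) + σ)) * ENNReal.ofReal (k * R ^ N) := by
        rw [← ENNReal.ofReal_mul (by positivity), ← ENNReal.ofReal_mul (by positivity),
          Real.rpow_add hR, Real.rpow_natCast]
        congr 1
        field_simp
    _ ≤ ENNReal.ofReal (|u x| ^ p / R ^ ((N : ℝ) + σ)) * volume (Metric.ball x R \ Ω) := by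
        gcongr
    _ = ∫⁻ _ in Metric.ball x R \ Ω, ENNReal.ofReal (|u x| ^ p / R ^ ((N : ℝ) + σ)) := by
        rw [setLIntegral_const]
    _ ≤ ∫⁻ y in Metric.ball x R \ Ω,
          ENNReal.ofReal (|u x - u y| ^ p / ‖x - y‖ ^ ((N : ℝ) + σ)) := by
        refine setLIntegral_mono' (Metric.isOpen_ball.measurableSet.diff hΩ) fun y hy => ?_
        have hxy : 0 < ‖x - y‖ :=
          norm_pos_iff.2 (sub_ne_zero.2 fun h => hy.2 (h ▸ hx))
        have hlt : ‖x - y‖ ≤ R := by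
          rw [← dist_eq_norm, dist_comm]
          exact (Metric.mem_ball.1 hy.1).le
        rw [hu y hy.2, sub_zero]
        gcongr
    _ ≤ _ := setLIntegral_le_lintegral _ _

/-- Comparison of the geometric weight `|Ω| ^ (1 / θ) * r ^ (σ - N / θ)` with `R ^ σ`,
where `|Ω| = k R ^ N` and `R ≤ 2 r`. -/
lemma mul_rpow_le_rpow_mul_rpow {n σ k R r θ : ℝ} (hn : 0 < n) (hσ : 0 < σ) (hσn : σ < n)
    (hk : 0 < k) (hR : 0 < R) (hr : R ≤ 2 * r) (hθ : n / σ < θ) :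
    min 1 k * 2 ^ (-σ) * R ^ σ ≤ (k * R ^ n) ^ (1 / θ) * r ^ (σ - n / θ) := by
  have h1 : 1 < n / σ := (one_lt_div hσ).2 hσn
  have hθ0 : 0 < θ := by linarith
  have hexp : 0 < σ - n / θ := by
    rw [div_lt_iff₀ hσ] at hθ
    rw [sub_pos, div_lt_iff₀ hθ0]
    linarith
  have hk' : min 1 k ≤ k ^ (1 / θ) := by
    have hθ1 : 1 / θ ≤ 1 := by
      rw [div_le_one hθ0]
      linarith
    rcases le_total 1 k with h | h
    · exact (min_le_left _ _).trans (Real.one_le_rpow h (by positivity))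
    · refine (min_le_right _ _).trans ?_
      simpa using Real.rpow_le_rpow_of_exponent_ge hk h hθ1
  have h2 : (2 : ℝ) ^ (-σ) ≤ 2 ^ (-(σ - n / θ)) :=
    Real.rpow_le_rpow_of_exponent_le one_le_two (by linarith [div_pos hn hθ0])
  calc min 1 k * 2 ^ (-σ) * R ^ σ
      ≤ k ^ (1 / θ) * 2 ^ (-(σ - n / θ)) * R ^ σ := by gcongr
    _ = (k * R ^ n) ^ (1 / θ) * (R / 2) ^ (σ - n / θ) := by
        rw [Real.mul_rpow hk.le (by positivity), ← Real.rpow_mul hR.le,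
          Real.div_rpow hR.le zero_le_two, Real.rpow_neg zero_le_two, mul_one_div]
        have : R ^ σ = R ^ (n / θ) * R ^ (σ - n / θ) := by
          rw [← Real.rpow_add hR]
          congr 1
          ring
        rw [this]
        ring
    _ ≤ (k * R ^ n) ^ (1 / θ) * r ^ (σ - n / θ) := by
        gcongr
        linarith

/-- Lower bound for the first Dirichlet eigenvalue of the fractional `p`-Laplacian
(Euclidean case): there is `C = C(N,p,s) > 0` such that for every bounded measurable
`Ω ⊆ ℝ^N` with `0 < |Ω| < ∞` and inner radius `r_Ω = sup {|x| : x ∈ Ω} ∈ (0,∞)`, every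
`θ ∈ (N/(sp), ∞)` and every `u ∈ C_c^∞(Ω)` not identically zero,
`[u]_{s,p}^p ≥ (C / (|Ω|^{1/θ} r_Ω^{sp - N/θ})) ‖u‖_{L^p(Ω)}^p`; in particular the first
eigenvalue `λ₁` satisfies `λ₁ ≥ sup_θ C / (|Ω|^{1/θ} r_Ω^{sp - N/θ})`. -/
theorem first_eigenvalue_lower_bound_fractional_pLaplacian
    (N : ℕ) (hN : 1 ≤ N) (p s : ℝ) (hp : 1 < p) (hs : s ∈ Set.Ioo (0 : ℝ) 1)
    (hNs : s * p < N) :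
    ∃ C : ℝ, 0 < C ∧
      ∀ Ω : Set (EuclideanSpace ℝ (Fin N)), MeasurableSet Ω → Bornology.IsBounded Ω →
        0 < volume Ω → volume Ω < ⊤ →
      ∀ rΩ : ℝ, rΩ = sSup ((fun x : EuclideanSpace ℝ (Fin N) => ‖x‖) '' Ω) → 0 < rΩ →
      ∀ θ : ℝ, (N : ℝ) / (s * p) < θ →
      ∀ u : EuclideanSpace ℝ (Fin N) → ℝ, ContDiff ℝ (⊤ : ℕ∞) u → HasCompactSupport u →
        tsupport u ⊆ Ω → u ≠ 0 →
        ENNReal.ofReal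
            (C / ((volume Ω).toReal ^ (1 / θ) * rΩ ^ (s * p - (N : ℝ) / θ))) *
            ∫⁻ x in Ω, ENNReal.ofReal (|u x| ^ p) ≤
          ∫⁻ x, ∫⁻ y,
            ENNReal.ofReal (|u x - u y| ^ p / ‖x - y‖ ^ ((N : ℝ) + s * p)) := by
  have : NeZero N := ⟨by omega⟩
  obtain ⟨hs0, -⟩ := hs
  have hn : (0 : ℝ) < N := by exact_mod_cast hN
  have hσ : 0 < s * p := mul_pos hs0 (by linarith)
  let E := EuclideanSpace ℝ (Fin N)
  obtain ⟨k, hk, hω⟩ : ∃ k : ℝ, 0 < k ∧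
      volume (Metric.ball (0 : E) 1) = ENNReal.ofReal (2 * k) := by
    have hpos : 0 < volume.real (Metric.ball (0 : E) 1) :=
      ENNReal.toReal_pos (Metric.measure_ball_pos _ _ one_pos).ne' measure_ball_lt_top.ne
    refine ⟨volume.real (Metric.ball (0 : E) 1) / 2, by positivity, ?_⟩
    rw [mul_div_cancel₀ _ two_ne_zero, ofReal_measureReal measure_ball_lt_top.ne]
  refine ⟨k * (min 1 k * 2 ^ (-(s * p))), by positivity, ?_⟩
  intro Ω hΩ hb hpos hfin r hr hr0 θ hθ u _ _ hsupp _
  have hV : 0 < (volume Ω).toReal := ENNReal.toReal_pos hpos.ne' hfin.ne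
  obtain ⟨R, hR, hRN⟩ : ∃ R : ℝ, 0 < R ∧ (volume Ω).toReal = k * R ^ N := by
    refine ⟨((volume Ω).toReal / k) ^ ((N : ℝ)⁻¹), by positivity, ?_⟩
    rw [Real.rpow_inv_natCast_pow (by positivity) (by omega)]
    field_simp
  have hvol : volume Ω = ENNReal.ofReal (k * R ^ N) := by
    rw [← hRN, ENNReal.ofReal_toReal hfin.ne]
  have hball (x : E) : volume (Metric.ball x R) = ENNReal.ofReal (2 * (k * R ^ N)) := by
    rw [Measure.addHaar_ball volume x hR.le, hω, ← ENNReal.ofReal_mul (by positivity)]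
    simp only [E, finrank_euclideanSpace_fin]
    congr 1
    ring
  have hsub : Ω ⊆ Metric.closedBall 0 r := by
    intro x hx
    rw [mem_closedBall_zero_iff, hr]
    refine le_csSup ?_ (Set.mem_image_of_mem _ hx)
    obtain ⟨M, hM⟩ := hb.exists_norm_le
    exact ⟨M, Set.forall_mem_image.2 hM⟩
  have hRr : R ≤ 2 * r := by
    have h := measure_mono (μ := volume) hsub
    rw [hvol, Measure.addHaar_closedBall volume _ hr0.le, hω,
      ← ENNReal.ofReal_mul (by positivity), finrank_euclideanSpace_fin,
      ENNReal.ofReal_le_ofReal_iff (by positivity)] at h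
    refine le_of_pow_le_pow_left₀ (n := N) (by omega) (by positivity) ?_
    have h2 : (2 : ℝ) ≤ 2 ^ N := le_self_pow₀ one_le_two (by omega)
    calc R ^ N ≤ 2 * r ^ N := le_of_mul_le_mul_left (by linarith) hk
      _ ≤ 2 ^ N * r ^ N := by gcongr
      _ = (2 * r) ^ N := (mul_pow _ _ _).symm
  refine le_trans ?_ (ofReal_mul_lintegral_le_gagliardo hσ hk hR hΩ hvol hball
    fun x hx => image_eq_zero_of_notMem_tsupport fun h => hx (hsupp h))
  gcongr ENNReal.ofReal ?_ * _
  have hcmp := mul_rpow_le_rpow_mul_rpow hn hσ hNs hk hR hRr hθ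
  rw [Real.rpow_natCast, ← hRN] at hcmp
  rw [div_le_div_iff₀ (by positivity) (by positivity), mul_assoc]
  exact mul_le_mul_of_nonneg_left hcmp hk.le
end
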